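/- There are infinitely many primes p that have at least twice as many ones as zeros in their binary expansion; that is, the set of primes p for which 2·(L(p) − s_2(p)) ≤ s_2(p), where L(p) is the number of binary digits of p and s_2(p) is the number of ones in the binary expansion of p, is infinite. -/

import Mathlib

def BF (S T : Finset ℕ) (K : ℕ → ℕ → ℝ) (C : ℝ) : Prop :=
  ∀ α β : ℕ → ℝ, |∑ m ∈ S, ∑ e ∈ T, α m * β e * K m e| ≤
    C * (√(∑ m ∈ S, α m ^ 2) * √(∑ e ∈ T, β e ^ 2))

lemma BF_block {S T : Finset ℕ} {K : ℕ → ℕ → ℝ} {C : ℝ} (hC : 0 ≤ C) (h : BF S T K C)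
    (R : ℕ) (u v : ℕ → Option ℕ) (hu : ∀ m ∈ S, ∀ a, u m = some a → a < R) :
    BF S T (fun m e => if ∃ a, u m = some a ∧ v e = some a then K m e else 0) C := by
  intro α β
  have key : ∑ m ∈ S, ∑ e ∈ T, α m * β e *
      (if ∃ a, u m = some a ∧ v e = some a then K m e else 0) =
      ∑ a ∈ Finset.range R, ∑ m ∈ S, ∑ e ∈ T,
        (if u m = some a then α m else 0) * (if v e = some a then β e else 0) * K m e := by
    symm
    rw [Finset.sum_comm]
    refine Finset.sum_congr rfl fun m hm => ?_
    rw [Finset.sum_comm]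
    refine Finset.sum_congr rfl fun e he => ?_
    split_ifs with hh
    · obtain ⟨a, ha, hb⟩ := hh
      rw [Finset.sum_eq_single a]
      · simp [ha, hb]
      · intro b _ hba
        have : u m ≠ some b := by rw [ha]; simpa using hba.symm
        simp [this]
      · intro hn
        exact absurd (Finset.mem_range.2 (hu m hm a ha)) hn
    · rw [mul_zero]
      refine Finset.sum_eq_zero fun a _ => ?_
      by_cases h1 : u m = some a
      · have : v e ≠ some a := fun h2 => hh ⟨a, h1, h2⟩
        simp [this]
      · simp [h1]
  rw [key]
  have part : ∀ (S : Finset ℕ) (u : ℕ → Option ℕ) (α : ℕ → ℝ),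
      ∑ a ∈ Finset.range R, ∑ m ∈ S, (if u m = some a then α m else 0) ^ 2 ≤ ∑ m ∈ S, α m ^ 2 := by
    intro S u α
    rw [Finset.sum_comm]
    refine Finset.sum_le_sum fun m _ => ?_
    cases hum : u m with
    | none => simp; positivity
    | some b =>
      have : ∀ a ∈ Finset.range R, (if some b = some a then α m else 0) ^ 2 =
          if b = a then α m ^ 2 else 0 := by
        intro a _; by_cases hab : b = a <;> simp [hab]
      rw [Finset.sum_congr rfl this, Finset.sum_ite_eq]
      split_ifs
      · exact le_rfl
      · positivity
  calc _ ≤ ∑ a ∈ Finset.range R, |∑ m ∈ S, ∑ e ∈ T,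
        (if u m = some a then α m else 0) * (if v e = some a then β e else 0) * K m e| :=
        Finset.abs_sum_le_sum_abs _ _
    _ ≤ ∑ a ∈ Finset.range R, C * (√(∑ m ∈ S, (if u m = some a then α m else 0) ^ 2) *
          √(∑ e ∈ T, (if v e = some a then β e else 0) ^ 2)) :=
        Finset.sum_le_sum fun a _ => h _ _
    _ = C * ∑ a ∈ Finset.range R, (√(∑ m ∈ S, (if u m = some a then α m else 0) ^ 2) *
          √(∑ e ∈ T, (if v e = some a then β e else 0) ^ 2)) := by rw [Finset.mul_sum]
    _ ≤ C * (√(∑ a ∈ Finset.range R, ∑ m ∈ S, (if u m = some a then α m else 0) ^ 2) *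
          √(∑ a ∈ Finset.range R, ∑ e ∈ T, (if v e = some a then β e else 0) ^ 2)) := by
        gcongr
        exact Real.sum_sqrt_mul_sqrt_le _ (fun _ => Finset.sum_nonneg fun _ _ => sq_nonneg _)
          (fun _ => Finset.sum_nonneg fun _ _ => sq_nonneg _)
    _ ≤ _ := by
        gcongr
        · exact part S u α
        · exact part T v β

lemma BF_couple {S T : Finset ℕ} {K : ℕ → ℕ → ℝ} {C : ℝ} (hC : 0 ≤ C) (h : BF S T K C)
    (J : ℕ) : ∀ (u v : ℕ → ℕ), (∀ m ∈ S, u m < 2 ^ J) → (∀ e ∈ T, v e < 2 ^ J) →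
    BF S T (fun m e => if u m < v e then K m e else 0) (J * C) := by
  induction J with
  | zero =>
    intro u v hu hv α β
    have : ∑ m ∈ S, ∑ e ∈ T, α m * β e * (if u m < v e then K m e else 0) = 0 := by
      refine Finset.sum_eq_zero fun m _ => Finset.sum_eq_zero fun e he => ?_
      have := hv e he
      have : ¬ (u m < v e) := by simp at this; omega
      simp [this]
    rw [this]; simp
  | succ J ih =>
    intro u v hu hv α β
    have h1 := ih (fun m => u m / 2) (fun e => v e / 2)
      (fun m hm => by have := hu m hm; rw [pow_succ] at this; omega)
      (fun m hm => by have := hv m hm; rw [pow_succ] at this; omega) α β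
    have h2 := BF_block hC h (2 ^ J) (fun m => if u m % 2 = 0 then some (u m / 2) else none)
      (fun e => if v e % 2 = 1 then some (v e / 2) else none) (by
        intro m hm a ha
        have := hu m hm; rw [pow_succ] at this
        split_ifs at ha
        simp at ha; omega) α β
    have : ∑ m ∈ S, ∑ e ∈ T, α m * β e * (if u m < v e then K m e else 0) =
      ∑ m ∈ S, ∑ e ∈ T, α m * β e * (if u m / 2 < v e / 2 then K m e else 0) +
      ∑ m ∈ S, ∑ e ∈ T, α m * β e * (if ∃ a, (if u m % 2 = 0 then some (u m / 2) else none) = some a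
         ∧ (if v e % 2 = 1 then some (v e / 2) else none) = some a then K m e else 0) := by
      rw [← Finset.sum_add_distrib]
      refine Finset.sum_congr rfl fun m _ => ?_
      rw [← Finset.sum_add_distrib]
      refine Finset.sum_congr rfl fun e _ => ?_
      have hiff : (∃ a, (if u m % 2 = 0 then some (u m / 2) else none) = some a
         ∧ (if v e % 2 = 1 then some (v e / 2) else none) = some a) ↔
         (u m % 2 = 0 ∧ v e % 2 = 1 ∧ u m / 2 = v e / 2) := by
        constructor
        · rintro ⟨a, ha, hb⟩
          split_ifs at ha hb
          simp at ha hb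
          omega
        · rintro ⟨ha, hb, hc⟩
          exact ⟨u m / 2, by simp [ha], by simp [hb, hc]⟩
      simp only [hiff]
      by_cases c1 : u m / 2 < v e / 2
      · have c2 : u m < v e := by omega
        have c3 : ¬ (u m % 2 = 0 ∧ v e % 2 = 1 ∧ u m / 2 = v e / 2) := by omega
        rw [if_pos c1, if_pos c2, if_neg c3]; ring
      · by_cases c2 : u m < v e
        · have c3 : (u m % 2 = 0 ∧ v e % 2 = 1 ∧ u m / 2 = v e / 2) := by omega
          rw [if_neg c1, if_pos c2, if_pos c3]; ring
        · have c3 : ¬ (u m % 2 = 0 ∧ v e % 2 = 1 ∧ u m / 2 = v e / 2) := by omega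
          rw [if_neg c1, if_neg c2, if_neg c3]; ring
    rw [this]
    refine (abs_add_le _ _).trans ((add_le_add h1 h2).trans (le_of_eq ?_))
    push_cast; ring


noncomputable def Wt {ι : Type} [Fintype ι] (q : ℕ) (b : ι → ZMod q) (n : ℕ) : ℝ :=
  ∑ i, if b i = (n : ZMod q) then (1 : ℝ) else 0

open Classical in
noncomputable def Dl {ι : Type} [Fintype ι] (q : ℕ) (b : ι → ZMod q) (n : ℕ) : ℝ :=
  Wt q b n - (Fintype.card ι / q.totient : ℝ) * (if IsUnit (n : ZMod q) then 1 else 0)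

lemma Dl_expand {ι : Type} [Fintype ι] (q : ℕ) [NeZero q] (b : ι → ZMod q)
    (hb : ∀ i, IsUnit (b i)) (n : ℕ) :
    ((q.totient : ℝ) * Dl q b n : ℂ) =
      ∑ χ ∈ (Finset.univ : Finset (DirichletCharacter ℂ q)).erase 1,
        (∑ i, χ (b i)⁻¹) * χ n := by
  classical
  have hφ : (q.totient : ℝ) ≠ 0 := by
    exact_mod_cast (Nat.totient_pos.2 (Nat.pos_of_ne_zero (NeZero.ne q))).ne'
  have h1 : ∑ χ : DirichletCharacter ℂ q, (∑ i, χ (b i)⁻¹) * χ n =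
      ((q.totient : ℝ) * Wt q b n : ℂ) := by
    simp only [Finset.sum_mul]
    rw [Finset.sum_comm]
    simp only [DirichletCharacter.sum_char_inv_mul_char_eq ℂ (hb _)]
    unfold Wt
    push_cast
    rw [Finset.mul_sum]
    refine Finset.sum_congr rfl fun i _ => ?_
    split_ifs <;> simp
  have h2 : (∑ i, (1 : DirichletCharacter ℂ q) (b i)⁻¹) * (1 : DirichletCharacter ℂ q) n =
      (Fintype.card ι : ℂ) * (if IsUnit (n : ZMod q) then 1 else 0) := by
    have : ∀ i, (1 : DirichletCharacter ℂ q) (b i)⁻¹ = 1 := by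
      intro i
      refine MulChar.one_apply ?_
      have := ZMod.inv_mul_of_unit _ (hb i)
      exact IsUnit.of_mul_eq_one _ this
    simp only [this]
    congr 1
    · simp
    · split_ifs with h
      · exact MulChar.one_apply h
      · exact MulChar.map_nonunit _ h
  have h3 := Finset.add_sum_erase (Finset.univ : Finset (DirichletCharacter ℂ q))
    (fun χ => (∑ i, χ (b i)⁻¹) * χ n) (Finset.mem_univ 1)
  rw [h1, h2] at h3
  rw [← eq_sub_iff_add_eq'] at h3
  rw [h3]
  unfold Dl
  have : ((q.totient : ℝ) : ℂ) ≠ 0 := by exact_mod_cast hφ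
  by_cases h : IsUnit (n : ZMod q)
  · simp only [h, if_true]; push_cast at this ⊢; field_simp
  · simp only [h, if_false]; push_cast; ring

lemma count_class (q : ℕ) [NeZero q] (M : ℕ) (a : ℕ) :
    ∑ m ∈ Finset.range M, (if (a : ZMod q) = (m : ZMod q) then (1 : ℝ) else 0) ≤ M / q + 1 := by
  have hq : 0 < q := Nat.pos_of_ne_zero (NeZero.ne q)
  have h := Nat.count_modEq_card M hq a
  rw [Nat.count_eq_card_filter_range] at h
  have e : ∑ m ∈ Finset.range M, (if (a : ZMod q) = (m : ZMod q) then (1 : ℝ) else 0) =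
      ((Finset.range M).filter (fun m => m ≡ a [MOD q])).card := by
    rw [Finset.sum_ite, Finset.sum_const_zero, add_zero, Finset.sum_const, nsmul_eq_mul, mul_one]
    congr 2
    ext m
    simp only [Finset.mem_filter, ZMod.natCast_eq_natCast_iff]
    exact and_congr_right fun _ => ⟨fun h => h.symm, fun h => h.symm⟩
  rw [e, h]
  have h1 : ((M / q : ℕ) : ℝ) ≤ M / q := Nat.cast_div_le
  have h2 : ((if a % q < M % q then 1 else 0 : ℕ) : ℝ) ≤ 1 := by split_ifs <;> simp
  push_cast at h2 ⊢
  linarith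

lemma char_large_sieve (q : ℕ) [NeZero q] (M : ℕ) (α : ℕ → ℝ) :
    ∑ χ : DirichletCharacter ℂ q, ‖∑ m ∈ Finset.range M, (α m : ℂ) * χ m‖ ^ 2 ≤
      q.totient * ((M / q + 1) * ∑ m ∈ Finset.range M, α m ^ 2) := by
  classical
  have key : ((∑ χ : DirichletCharacter ℂ q, ‖∑ m ∈ Finset.range M, (α m : ℂ) * χ m‖ ^ 2 : ℝ) : ℂ)
      = ((∑ m ∈ Finset.range M, ∑ m' ∈ Finset.range M, α m * α m' *
          (if IsUnit (m : ZMod q) ∧ (m : ZMod q) = m' then (q.totient : ℝ) else 0) : ℝ) : ℂ) := by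
    push_cast
    have h1 : ∀ χ : DirichletCharacter ℂ q,
        ((‖∑ m ∈ Finset.range M, (α m : ℂ) * χ m‖ : ℂ)) ^ 2 =
        ∑ m ∈ Finset.range M, ∑ m' ∈ Finset.range M,
          (α m : ℂ) * α m' * (star (χ m) * χ m') := by
      intro χ
      rw [← Complex.conj_mul', map_sum, Finset.sum_mul_sum]
      refine Finset.sum_congr rfl fun m _ => Finset.sum_congr rfl fun m' _ => ?_
      simp only [map_mul, Complex.conj_ofReal]
      rw [← starRingEnd_apply]; ring
    simp only [h1]
    rw [Finset.sum_comm]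
    refine Finset.sum_congr rfl fun m _ => ?_
    rw [Finset.sum_comm]
    refine Finset.sum_congr rfl fun m' _ => ?_
    rw [← Finset.mul_sum]
    congr 1
    by_cases hm : IsUnit (m : ZMod q)
    · have : ∀ χ : DirichletCharacter ℂ q, star (χ m) = χ (m : ZMod q)⁻¹ := by
        intro χ
        have e1 : χ⁻¹ (m : ZMod q) * χ m = 1 := by
          rw [← MulChar.mul_apply, MulChar.inv_mul, MulChar.one_apply hm]
        have e2 : χ (m : ZMod q)⁻¹ * χ m = 1 := by
          rw [← map_mul, ZMod.inv_mul_of_unit _ hm, map_one]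
        rw [MulChar.star_apply']
        have e3 : χ (m : ZMod q) ≠ 0 := by
          intro h; rw [h, mul_zero] at e2; exact zero_ne_one e2
        exact mul_right_cancel₀ e3 (e1.trans e2.symm)
      simp only [this, DirichletCharacter.sum_char_inv_mul_char_eq ℂ hm, hm, true_and]
      split_ifs <;> simp
    · have : ∀ χ : DirichletCharacter ℂ q, χ (m : ZMod q) = 0 := fun χ => MulChar.map_nonunit _ hm
      simp [this, hm]
  have key' := Complex.ofReal_injective key
  rw [key']
  have hφ : (0 : ℝ) ≤ q.totient := Nat.cast_nonneg _
  have step : ∀ m ∈ Finset.range M, ∀ m' ∈ Finset.range M, α m * α m' *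
          (if IsUnit (m : ZMod q) ∧ (m : ZMod q) = m' then (q.totient : ℝ) else 0) ≤
      q.totient / 2 * (α m ^ 2 * (if (m : ZMod q) = m' then (1 : ℝ) else 0)) +
      q.totient / 2 * (α m' ^ 2 * (if (m' : ZMod q) = m then (1 : ℝ) else 0)) := by
    intro m _ m' _
    by_cases h1 : (m : ZMod q) = m'
    · have h1' : (m' : ZMod q) = m := h1.symm
      simp only [h1, and_true, if_true, mul_one]
      split_ifs
      · nlinarith [sq_nonneg (α m - α m'), mul_nonneg hφ (sq_nonneg (α m - α m'))]
      · rw [mul_zero]; positivity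
    · have h1' : ¬ (m' : ZMod q) = m := fun h => h1 h.symm
      simp [h1, h1']
  calc _ ≤ ∑ m ∈ Finset.range M, ∑ m' ∈ Finset.range M,
      (q.totient / 2 * (α m ^ 2 * (if (m : ZMod q) = m' then (1 : ℝ) else 0)) +
      q.totient / 2 * (α m' ^ 2 * (if (m' : ZMod q) = m then (1 : ℝ) else 0))) :=
        Finset.sum_le_sum fun m hm => Finset.sum_le_sum fun m' hm' => step m hm m' hm'
    _ = ∑ m ∈ Finset.range M, q.totient * (α m ^ 2 * ∑ m' ∈ Finset.range M,
          (if (m : ZMod q) = m' then (1 : ℝ) else 0)) := by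
        simp only [Finset.sum_add_distrib]
        rw [Finset.sum_comm (f := fun (m m' : ℕ) => (q.totient : ℝ) / 2 *
          (α m' ^ 2 * (if (m' : ZMod q) = m then (1 : ℝ) else 0)))]
        rw [← Finset.sum_add_distrib]
        refine Finset.sum_congr rfl fun m _ => ?_
        rw [← Finset.mul_sum, ← Finset.mul_sum]
        ring
    _ ≤ ∑ m ∈ Finset.range M, q.totient * (α m ^ 2 * (M / q + 1)) := by
        refine Finset.sum_le_sum fun m _ => ?_
        gcongr
        exact count_class q M m
    _ = _ := by
        rw [← Finset.mul_sum, ← Finset.sum_mul]; ring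

lemma Dl_BF {ι : Type} [Fintype ι] (q : ℕ) [NeZero q] (b : ι → ZMod q)
    (hb : ∀ i, IsUnit (b i)) (σ : ℝ) (hσ0 : 0 ≤ σ)
    (hσ : ∀ χ : DirichletCharacter ℂ q, χ ≠ 1 → ‖∑ i, χ (b i)‖ ≤ σ) (M N : ℕ) :
    BF (Finset.range M) (Finset.range N) (fun m e => Dl q b (m * e))
      (σ * (√((M : ℝ) / q + 1) * √((N : ℝ) / q + 1))) := by
  classical
  intro α β
  have hφ : (0 : ℝ) < q.totient := by
    exact_mod_cast (Nat.totient_pos.2 (Nat.pos_of_ne_zero (NeZero.ne q)))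
  set A : DirichletCharacter ℂ q → ℂ := fun χ => ∑ m ∈ Finset.range M, (α m : ℂ) * χ m with hA
  set B : DirichletCharacter ℂ q → ℂ := fun χ => ∑ m ∈ Finset.range N, (β m : ℂ) * χ m with hB
  have e1 : (((q.totient : ℝ) * (∑ m ∈ Finset.range M, ∑ e ∈ Finset.range N,
      α m * β e * Dl q b (m * e)) : ℝ) : ℂ) =
      ∑ χ ∈ (Finset.univ : Finset (DirichletCharacter ℂ q)).erase 1,
        (∑ i, χ (b i)⁻¹) * (A χ * B χ) := by
    have eχ : ∀ χ, A χ * B χ = ∑ m ∈ Finset.range M, ∑ e ∈ Finset.range N,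
        (α m : ℂ) * χ m * ((β e : ℂ) * χ e) := fun χ => Finset.sum_mul_sum _ _ _ _
    simp only [eχ, Finset.mul_sum]
    push_cast
    symm
    rw [Finset.sum_comm]
    refine Finset.sum_congr rfl fun m _ => ?_
    rw [Finset.sum_comm]
    refine Finset.sum_congr rfl fun e _ => ?_
    symm
    have := Dl_expand q b hb (m * e)
    calc _ = (α m : ℂ) * β e * ((q.totient : ℝ) * Dl q b (m * e) : ℂ) := by push_cast; ring
      _ = _ := by
        rw [this, Finset.mul_sum]
        refine Finset.sum_congr rfl fun χ _ => ?_
        push_cast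
        rw [map_mul]; ring
  have e2 : |(q.totient : ℝ) * ∑ m ∈ Finset.range M, ∑ e ∈ Finset.range N,
      α m * β e * Dl q b (m * e)| ≤ σ * ∑ χ, ‖A χ‖ * ‖B χ‖ := by
    rw [← Real.norm_eq_abs, ← Complex.norm_real, e1]
    refine (norm_sum_le _ _).trans ?_
    rw [Finset.mul_sum]
    refine (Finset.sum_le_sum (g := fun χ => σ * (‖A χ‖ * ‖B χ‖)) ?_).trans
      (Finset.sum_le_sum_of_subset_of_nonneg (Finset.erase_subset _ _) ?_)
    · intro χ hχ
      have hχ1 : χ ≠ 1 := Finset.ne_of_mem_erase hχ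
      have hχ2 : χ⁻¹ ≠ 1 := by simpa using hχ1
      have : ∑ i, χ (b i)⁻¹ = ∑ i, χ⁻¹ (b i) := by
        refine Finset.sum_congr rfl fun i _ => ?_
        have e1 : χ⁻¹ (b i) * χ (b i) = 1 := by
          rw [← MulChar.mul_apply, MulChar.inv_mul, MulChar.one_apply (hb i)]
        have e2 : χ (b i)⁻¹ * χ (b i) = 1 := by
          rw [← map_mul, ZMod.inv_mul_of_unit _ (hb i), map_one]
        have e3 : χ (b i) ≠ 0 := by
          intro h; rw [h, mul_zero] at e2; exact zero_ne_one e2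
        exact mul_right_cancel₀ e3 (e2.trans e1.symm)
      rw [norm_mul, norm_mul, this]
      gcongr
      exact hσ _ hχ2
    · intro χ _ _; positivity
  have e3 : ∑ χ, ‖A χ‖ * ‖B χ‖ ≤ √(∑ χ, ‖A χ‖ ^ 2) * √(∑ χ, ‖B χ‖ ^ 2) :=
    Real.sum_mul_le_sqrt_mul_sqrt _ _ _
  have e4 : √(∑ χ, ‖A χ‖ ^ 2) * √(∑ χ, ‖B χ‖ ^ 2) ≤
      √(q.totient * ((M / q + 1) * ∑ m ∈ Finset.range M, α m ^ 2)) *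
      √(q.totient * ((N / q + 1) * ∑ m ∈ Finset.range N, β m ^ 2)) := by
    gcongr
    · exact char_large_sieve q M α
    · exact char_large_sieve q N β
  have e5 : √(q.totient * (((M : ℝ) / q + 1) * ∑ m ∈ Finset.range M, α m ^ 2)) *
      √(q.totient * (((N : ℝ) / q + 1) * ∑ m ∈ Finset.range N, β m ^ 2)) =
      q.totient * (√((M : ℝ) / q + 1) * √((N : ℝ) / q + 1) *
       (√(∑ m ∈ Finset.range M, α m ^ 2) * √(∑ e ∈ Finset.range N, β e ^ 2))) := by
    rw [Real.sqrt_mul hφ.le, Real.sqrt_mul hφ.le, Real.sqrt_mul (by positivity),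
      Real.sqrt_mul (by positivity)]
    have := Real.mul_self_sqrt hφ.le
    calc _ = (√(q.totient : ℝ) * √(q.totient : ℝ)) * (√((M : ℝ) / q + 1) * √((N : ℝ) / q + 1) *
       (√(∑ m ∈ Finset.range M, α m ^ 2) * √(∑ e ∈ Finset.range N, β e ^ 2))) := by ring
      _ = _ := by rw [this]
  rw [abs_mul, abs_of_pos hφ] at e2
  have e6 := e2.trans (mul_le_mul_of_nonneg_left (e3.trans (e4.trans_eq e5)) hσ0)
  refine le_of_mul_le_mul_left (e6.trans_eq ?_) hφ
  ring


lemma sum_antiperiod (G : ℕ → ℂ) (f n : ℕ) (hf : f < n) (hG : ∀ j, G (j + 2 ^ f) = - G j) :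
    ∑ j ∈ Finset.range (2 ^ n), G j = 0 := by
  have h1 : ∀ N, ∑ j ∈ Finset.range (N * 2 ^ (f + 1)), G j = 0 := by
    intro N
    induction N with
    | zero => simp
    | succ N ih =>
      have : (N + 1) * 2 ^ (f + 1) = N * 2 ^ (f + 1) + 2 ^ f + 2 ^ f := by rw [pow_succ]; ring
      rw [this, Finset.sum_range_add, Finset.sum_range_add, ih, zero_add,
        ← Finset.sum_add_distrib]
      refine Finset.sum_eq_zero fun j _ => ?_
      have := hG (N * 2 ^ (f + 1) + j)
      rw [show N * 2 ^ (f + 1) + 2 ^ f + j = N * 2 ^ (f + 1) + j + 2 ^ f by ring, this]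
      ring
  have := h1 (2 ^ (n - (f + 1)))
  rwa [← pow_add, show n - (f + 1) + (f + 1) = n by omega] at this

section
variable {k : ℕ}

lemma zmod_even_or (a : ZMod (2 ^ k)) : ∃ b, a = 2 * b ∨ a = 1 + 2 * b := by
  refine ⟨((a.val / 2 : ℕ) : ZMod (2 ^ k)), ?_⟩
  have h := ZMod.natCast_zmod_val a
  rcases Nat.mod_two_eq_zero_or_one a.val with h1 | h1
  · left
    have : a.val = 2 * (a.val / 2) := by omega
    rw [← h]; nth_rewrite 1 [this]; push_cast; simp
  · right
    have : a.val = 1 + 2 * (a.val / 2) := by omega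
    rw [← h]; nth_rewrite 1 [this]; push_cast; simp

lemma isUnit_odd (b : ZMod (2 ^ k)) : IsUnit (1 + 2 * b) := by
  have h : IsNilpotent (2 * b) := by
    refine ⟨k, ?_⟩
    rw [mul_pow]
    have : ((2 ^ k : ℕ) : ZMod (2 ^ k)) = 0 := ZMod.natCast_self _
    push_cast at this
    rw [this, zero_mul]
  rw [add_comm]
  exact h.isUnit_add_one

lemma chi_even (hk : 1 ≤ k) (χ : DirichletCharacter ℂ (2 ^ k)) (b : ZMod (2 ^ k)) :
    χ (2 * b) = 0 := by
  have hn : Fact (1 < 2 ^ k) := ⟨Nat.one_lt_two_pow (by omega)⟩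
  have : ((2 ^ k : ℕ) : ZMod (2 ^ k)) = 0 := ZMod.natCast_self _
  push_cast at this
  refine MulChar.map_nonunit _ fun h => ?_
  have h2 : IsUnit (2 : ZMod (2 ^ k)) := isUnit_of_mul_isUnit_left h
  have := h2.pow k
  simp_all

lemma exists_cond (hk : 1 ≤ k) (χ : DirichletCharacter ℂ (2 ^ k)) (hχ : χ ≠ 1) :
    ∃ m, 2 ≤ m ∧ m ≤ k ∧ (∀ a c, χ (a + 2 ^ m * c) = χ a) ∧
      (∀ a, χ (a + 2 ^ (m - 1)) = - χ a) := by
  classical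
  have hz : ((2 ^ k : ℕ) : ZMod (2 ^ k)) = 0 := ZMod.natCast_self _
  push_cast at hz
  have ex : ∃ m, ∀ a c, χ (a + 2 ^ m * c) = χ a := ⟨k, by simp [hz]⟩
  obtain ⟨m, hm, hmin⟩ : ∃ m, (∀ a c, χ (a + 2 ^ m * c) = χ a) ∧
      ∀ n < m, ¬ ∀ a c, χ (a + 2 ^ n * c) = χ a :=
    ⟨Nat.find ex, Nat.find_spec ex, fun n hn => Nat.find_min ex hn⟩
  have hmk : m ≤ k := by
    by_contra h
    exact hmin k (by omega) (by simp [hz])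
  have hm2 : 2 ≤ m := by
    by_contra h
    apply hχ
    have h1 : ∀ b, χ (1 + 2 * b) = 1 := by
      intro b
      have : m = 0 ∨ m = 1 := by omega
      rcases this with h | h
      · have := hm 1 (2 * b); rw [h, pow_zero, one_mul] at this; rw [this, map_one]
      · have := hm 1 b; rw [h, pow_one] at this; rw [this, map_one]
    refine MulChar.ext fun a => ?_
    obtain ⟨b, hb | hb⟩ := zmod_even_or (a : ZMod (2 ^ k))
    · exfalso
      have := chi_even hk 1 b
      rw [← hb, MulChar.one_apply a.isUnit] at this
      exact one_ne_zero this
    · rw [MulChar.one_apply a.isUnit, hb, h1]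
  have hmul : ∀ a : ZMod (2 ^ k), χ (a + 2 ^ (m - 1)) = χ a * χ (1 + 2 ^ (m - 1)) := by
    intro a
    obtain ⟨b, hb | hb⟩ := zmod_even_or a
    · have e : a + 2 ^ (m - 1) = 2 * (b + 2 ^ (m - 2)) := by
        rw [hb, show m - 1 = m - 2 + 1 by omega, pow_succ]; ring
      rw [e, chi_even hk, hb, chi_even hk, zero_mul]
    · rw [← map_mul]
      have e : a * (1 + 2 ^ (m - 1)) = (a + 2 ^ (m - 1)) + 2 ^ m * b := by
        rw [hb, show (2 : ZMod (2 ^ k)) ^ m = 2 ^ (m - 1) * 2 by rw [← pow_succ]; congr 1; omega]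
        ring
      rw [e, hm]
  have hω2 : χ (1 + 2 ^ (m - 1)) * χ (1 + 2 ^ (m - 1)) = 1 := by
    rw [← hmul]
    have e : (1 + 2 ^ (m - 1) + 2 ^ (m - 1) : ZMod (2 ^ k)) = 1 + 2 ^ m * 1 := by
      rw [show (2 : ZMod (2 ^ k)) ^ m = 2 ^ (m - 1) * 2 by rw [← pow_succ]; congr 1; omega]
      ring
    rw [e, hm, map_one]
  have hω : χ (1 + 2 ^ (m - 1)) = -1 := by
    rcases mul_self_eq_one_iff.1 hω2 with h | h
    · exfalso
      refine hmin (m - 1) (by omega) fun a c => ?_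
      obtain ⟨b, hb | hb⟩ := zmod_even_or c
      · have e : a + 2 ^ (m - 1) * c = a + 2 ^ m * b := by
          rw [hb, show (2 : ZMod (2 ^ k)) ^ m = 2 ^ (m - 1) * 2 by rw [← pow_succ]; congr 1; omega]
          ring
        rw [e, hm]
      · have e : a + 2 ^ (m - 1) * c = (a + 2 ^ (m - 1)) + 2 ^ m * b := by
          rw [hb, show (2 : ZMod (2 ^ k)) ^ m = 2 ^ (m - 1) * 2 by rw [← pow_succ]; congr 1; omega]
          ring
        rw [e, hm, hmul, h, mul_one]
    · exact h
  exact ⟨m, hm2, hmk, hm, fun a => by rw [hmul, hω]; ring⟩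

lemma chi_unit_star (χ : DirichletCharacter ℂ (2 ^ k)) {a : ZMod (2 ^ k)} (ha : IsUnit a) :
    χ a * star (χ a) = 1 := by
  rw [MulChar.star_apply', ← MulChar.mul_apply, mul_comm, MulChar.inv_mul, MulChar.one_apply ha]

lemma twist (χ : DirichletCharacter ℂ (2 ^ k)) {m : ℕ}
    (h1 : ∀ a c, χ (a + 2 ^ m * c) = χ a) (h2 : ∀ a, χ (a + 2 ^ (m - 1)) = - χ a)
    {u D : ZMod (2 ^ k)} {f : ℕ} (c : ZMod (2 ^ k)) (hD : D * 2 ^ f = 2 ^ (m - 1) + 2 ^ m * c)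
    (hu : IsUnit u) (huf : IsUnit (u + 2 ^ f)) :
    χ (u + 2 ^ f + D) * star (χ (u + 2 ^ f)) = - (χ (u + D) * star (χ u)) := by
  have e : (u + D) * (u + 2 ^ f) = u * (u + 2 ^ f + D) + 2 ^ (m - 1) + 2 ^ m * c := by
    have : (u + D) * (u + 2 ^ f) = u * (u + 2 ^ f + D) + D * 2 ^ f := by ring
    rw [this, hD]; ring
  have e2 : χ (u + D) * χ (u + 2 ^ f) = - (χ u * χ (u + 2 ^ f + D)) := by
    rw [← map_mul, e, h1, h2, map_mul]
  have a1 := chi_unit_star χ hu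
  have a2 := chi_unit_star χ huf
  calc χ (u + 2 ^ f + D) * star (χ (u + 2 ^ f))
      = (χ u * χ (u + 2 ^ f + D)) * star (χ (u + 2 ^ f)) * star (χ u) := by
        linear_combination (-χ (u + 2 ^ f + D) * star (χ (u + 2 ^ f))) * a1
    _ = -(χ (u + D) * χ (u + 2 ^ f)) * star (χ (u + 2 ^ f)) * star (χ u) := by rw [e2]; ring
    _ = _ := by linear_combination (-χ (u + D) * star (χ u)) * a2

end

lemma cauchy_vdc {τ : Type} [Fintype τ] (N : ℕ) (F : ℕ → τ → ℂ)
    (hF : ∀ j t, ‖F j t‖ ≤ 1)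
    (hoff : ∀ t t', t ≠ t' → ∑ j ∈ Finset.range N, F j t * star (F j t') = 0) :
    ‖∑ j ∈ Finset.range N, ∑ t, F j t‖ ≤ N * √(Fintype.card τ) := by
  have h1 : ‖∑ j ∈ Finset.range N, ∑ t, F j t‖ ^ 2 ≤
      N * ∑ j ∈ Finset.range N, ‖∑ t, F j t‖ ^ 2 := by
    have := sq_sum_le_card_mul_sum_sq (s := Finset.range N) (f := fun j => ‖∑ t, F j t‖)
    rw [Finset.card_range] at this
    refine le_trans ?_ this
    gcongr
    exact norm_sum_le _ _
  have h2 : ((∑ j ∈ Finset.range N, ‖∑ t, F j t‖ ^ 2 : ℝ) : ℂ) =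
      ((∑ t, ∑ j ∈ Finset.range N, ‖F j t‖ ^ 2 : ℝ) : ℂ) := by
    push_cast
    have : ∀ j, (‖∑ t, F j t‖ : ℂ) ^ 2 = ∑ t, ∑ t', F j t * star (F j t') := by
      intro j
      rw [← Complex.mul_conj', map_sum, Finset.sum_mul_sum]; rfl
    simp only [this]
    rw [Finset.sum_comm]
    refine Finset.sum_congr rfl fun t _ => ?_
    rw [Finset.sum_comm, Finset.sum_eq_single t]
    · refine Finset.sum_congr rfl fun j _ => ?_
      rw [← Complex.mul_conj']; rfl
    · intro t' _ ht'
      exact hoff _ _ ht'.symm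
    · intro h; exact absurd (Finset.mem_univ _) h
  have h3 := Complex.ofReal_injective h2
  have h4 : ∑ t, ∑ j ∈ Finset.range N, ‖F j t‖ ^ 2 ≤ (Fintype.card τ : ℝ) * N := by
    calc _ ≤ ∑ t : τ, ∑ j ∈ Finset.range N, (1 : ℝ) := by
          refine Finset.sum_le_sum fun t _ => Finset.sum_le_sum fun j _ => ?_
          exact pow_le_one₀ (norm_nonneg _) (hF j t)
      _ = _ := by simp
  rw [h3] at h1
  have h5 : ‖∑ j ∈ Finset.range N, ∑ t, F j t‖ ^ 2 ≤ (N * √(Fintype.card τ)) ^ 2 := by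
    rw [mul_pow, Real.sq_sqrt (Nat.cast_nonneg _)]
    calc _ ≤ _ := h1
      _ ≤ (N : ℝ) * (Fintype.card τ * N) := by gcongr
      _ = _ := by ring
  exact le_of_sq_le_sq h5 (by positivity)

lemma off_diag {k m a r r' : ℕ} (χ : DirichletCharacter ℂ (2 ^ k)) (hm : 2 ≤ m)
    (h1 : ∀ a c, χ (a + 2 ^ m * c) = χ a) (h2 : ∀ a, χ (a + 2 ^ (m - 1)) = - χ a)
    (ha1 : 1 ≤ a) (ha : a + r' + 1 ≤ m) (ha2 : m ≤ a + 2 * r) (E' t t' : ℕ)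
    (ht : t < 2 ^ r') (htt : t' < t) :
    ∑ j ∈ Finset.range (2 ^ (2 * r - 1)),
      χ ((2 * j + 1 + 2 * E' + 2 ^ a * t : ℕ) : ZMod (2 ^ k)) *
        star (χ ((2 * j + 1 + 2 * E' + 2 ^ a * t' : ℕ) : ZMod (2 ^ k))) = 0 := by
  obtain ⟨v, w, hw, hvw⟩ := Nat.exists_eq_two_pow_mul_odd (n := t - t') (by omega)
  obtain ⟨c, hc⟩ := hw
  have hv : v < r' := by
    have : 2 ^ v ≤ t - t' := by rw [hvw]; exact Nat.le_mul_of_pos_right _ (by omega)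
    exact (Nat.pow_lt_pow_iff_right (by norm_num : 1 < 2)).1 (by omega : 2 ^ v < 2 ^ r')
  obtain ⟨f, hf⟩ : ∃ f, m - 1 = a + v + (f + 1) := ⟨m - 1 - a - v - 1, by omega⟩
  refine sum_antiperiod _ f (2 * r - 1) (by omega) fun j => ?_
  obtain ⟨a', rfl⟩ : ∃ a', a = a' + 1 := ⟨a - 1, by omega⟩
  have htd : t = t' + 2 ^ v * (2 * c + 1) := by rw [hc] at hvw; omega
  have := twist χ h1 h2 (u := ((2 * j + 1 + 2 * E' + 2 ^ (a' + 1) * t' : ℕ) : ZMod (2 ^ k)))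
    (D := 2 ^ (a' + 1) * (2 ^ v * (2 * c + 1))) (f := f + 1) c (by
      rw [show m = (a' + 1 + v + (f + 1)) + 1 by omega, Nat.add_sub_cancel]; ring)
    (by
      convert isUnit_odd (k := k) ((j + E' + 2 ^ a' * t' : ℕ) : ZMod (2 ^ k)) using 1
      push_cast; ring)
    (by
      convert isUnit_odd (k := k) ((j + E' + 2 ^ a' * t' + 2 ^ f : ℕ) : ZMod (2 ^ k)) using 1
      push_cast; ring)
  convert this using 3
  · congr 1; rw [htd]; push_cast; ring
  · congr 2; push_cast; ring
  · congr 1; rw [htd]; push_cast; ring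

lemma inner_bound {k m a r r' : ℕ} (χ : DirichletCharacter ℂ (2 ^ k)) (hm : 2 ≤ m)
    (h1 : ∀ a c, χ (a + 2 ^ m * c) = χ a) (h2 : ∀ a, χ (a + 2 ^ (m - 1)) = - χ a)
    (ha1 : 1 ≤ a) (ha : a + r' + 1 ≤ m) (ha2 : m ≤ a + 2 * r) (E' : ℕ) :
    ‖∑ j ∈ Finset.range (2 ^ (2 * r - 1)), ∑ t : Fin (2 ^ r'),
      χ ((2 * j + 1 + 2 * E' + 2 ^ a * t : ℕ) : ZMod (2 ^ k))‖ ≤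
        2 ^ (2 * r - 1) * √(2 ^ r') := by
  have := cauchy_vdc (τ := Fin (2 ^ r')) (2 ^ (2 * r - 1))
    (fun j t => χ ((2 * j + 1 + 2 * E' + 2 ^ a * t : ℕ) : ZMod (2 ^ k)))
    (fun j t => DirichletCharacter.norm_le_one _ _) (by
      intro t t' htt
      have : (t : ℕ) ≠ t' := fun h => htt (Fin.ext h)
      rcases lt_or_gt_of_ne this with h | h
      · have := congrArg star (off_diag χ hm h1 h2 ha1 ha ha2 E' t' t t'.isLt h)
        rw [star_sum, star_zero] at this
        rw [← this]
        refine Finset.sum_congr rfl fun j _ => ?_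
        rw [star_mul, star_star]
      · exact off_diag χ hm h1 h2 ha1 ha ha2 E' t t' t.isLt h)
  simpa using this

def cv (r : ℕ) {K T : ℕ} (j : ℕ) (t : Fin K → Fin T) : ℕ :=
  2 * j + 1 + ∑ i : Fin K, 2 ^ ((i + 1 : ℕ) * r) * (t i : ℕ)

abbrev Ix (r K r' : ℕ) := Fin (2 ^ (2 * r - 1)) × (Fin K → Fin (2 ^ r'))

def bv (r K r' : ℕ) (i : Ix r K r') : ZMod (2 ^ (K * r)) := - (cv r i.1 i.2 : ZMod (2 ^ (K * r)))

lemma card_Ix (r K r' : ℕ) : Fintype.card (Ix r K r') = 2 ^ (2 * r - 1) * (2 ^ r') ^ K := by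
  simp [Ix]

lemma cv_even_part {r : ℕ} (hr : 1 ≤ r) {K T : ℕ} (t : Fin K → Fin T) :
    ∃ E', ∑ i : Fin K, 2 ^ ((i + 1 : ℕ) * r) * (t i : ℕ) = 2 * E' := by
  have : 2 ∣ ∑ i : Fin K, 2 ^ ((i + 1 : ℕ) * r) * (t i : ℕ) := by
    refine Finset.dvd_sum fun i _ => Dvd.dvd.mul_right (dvd_pow_self 2 ?_) _
    have : 0 < ((i : ℕ) + 1) * r := by positivity
    omega
  exact this

lemma bv_unit {r K r' : ℕ} (hr : 1 ≤ r) (i : Ix r K r') : IsUnit (bv r K r' i) := by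
  unfold bv cv
  obtain ⟨E', hE⟩ := cv_even_part hr i.2
  rw [hE]
  refine IsUnit.neg ?_
  convert isUnit_odd (k := K * r) ((i.1 + E' : ℕ) : ZMod (2 ^ (K * r))) using 1
  push_cast; ring

lemma char_sum_bound {r K r' : ℕ} (hr : r' + 1 ≤ r) (hK : 1 ≤ K)
    (χ : DirichletCharacter ℂ (2 ^ (K * r))) (hχ : χ ≠ 1) :
    ‖∑ i, χ (bv r K r' i)‖ ≤ Fintype.card (Ix r K r') / √(2 ^ r') := by
  have hk : 1 ≤ K * r := Nat.mul_pos hK (by omega)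
  obtain ⟨m, hm, hmk, h1, h2⟩ := exists_cond hk χ hχ
  have e0 : ∀ i, χ (bv r K r' i) = χ (-1) * χ (cv r i.1 i.2 : ZMod (2 ^ (K * r))) := by
    intro i; rw [← map_mul]; congr 1; unfold bv; ring
  simp only [e0]
  rw [← Finset.mul_sum, norm_mul]
  have hle : ‖χ (-1)‖ ≤ 1 := DirichletCharacter.norm_le_one _ _
  refine (mul_le_of_le_one_left (norm_nonneg _) hle).trans ?_
  have hs : (0 : ℝ) < √(2 ^ r') := by positivity
  rw [Fintype.sum_prod_type, Finset.sum_comm]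
  by_cases hm2 : m ≤ 2 * r
  · have : ∑ y : Fin K → Fin (2 ^ r'), ∑ x : Fin (2 ^ (2 * r - 1)),
        χ (cv r x y : ZMod (2 ^ (K * r))) = 0 := by
      refine Finset.sum_eq_zero fun t _ => ?_
      rw [Fin.sum_univ_eq_sum_range (fun x => χ (cv r x t : ZMod (2 ^ (K * r))))]
      refine sum_antiperiod _ (m - 2) _ (by omega) fun j => ?_
      rw [← h2]
      congr 1
      unfold cv
      rw [show m - 1 = m - 2 + 1 by omega]
      push_cast; ring
    rw [this, norm_zero]; positivity
  · have hrpos : 0 < r := by omega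
    set w := (m - r' - 1) / r with hw
    have hw1 : 1 ≤ w := (Nat.one_le_div_iff hrpos).2 (by omega)
    have hwr : w * r ≤ m - r' - 1 := Nat.div_mul_le_self _ _
    have hwr2 : m - r' - 1 < w * r + r := by
      have := Nat.lt_div_mul_add (a := m - r' - 1) hrpos
      simpa [hw] using this
    have hwK : w - 1 < K := by
      have : w * r < K * r := by omega
      have := lt_of_mul_lt_mul_right this (Nat.zero_le r)
      omega
    set i0 : Fin K := ⟨w - 1, hwK⟩ with hi0
    rw [← (Equiv.funSplitAt i0 (Fin (2 ^ r'))).symm.sum_comp, Fintype.sum_prod_type,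
      Finset.sum_comm]
    have hb : ∀ y : {j // j ≠ i0} → Fin (2 ^ r'),
        ‖∑ x : Fin (2 ^ r'), ∑ j : Fin (2 ^ (2 * r - 1)),
          χ (cv r j ((Equiv.funSplitAt i0 (Fin (2 ^ r'))).symm (x, y)) : ZMod (2 ^ (K * r)))‖ ≤
        2 ^ (2 * r - 1) * √(2 ^ r') := by
      intro y
      have hpos : 0 < 2 ^ r' := by positivity
      set E0 := (Equiv.funSplitAt i0 (Fin (2 ^ r'))).symm (⟨0, hpos⟩, y) with hE0
      obtain ⟨E', hE'⟩ := cv_even_part (by omega : 1 ≤ r) E0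
      have key : ∀ (j : ℕ) (x : Fin (2 ^ r')),
          cv r j ((Equiv.funSplitAt i0 (Fin (2 ^ r'))).symm (x, y)) =
          2 * j + 1 + 2 * E' + 2 ^ (w * r) * x := by
        intro j x
        unfold cv
        rw [← hE', ← Finset.add_sum_erase _ _ (Finset.mem_univ i0),
          ← Finset.add_sum_erase (a := i0) _ (fun i : Fin K => 2 ^ ((i + 1 : ℕ) * r) * (E0 i : ℕ))
            (Finset.mem_univ i0)]
        have a1 : ∑ i ∈ Finset.univ.erase i0, 2 ^ ((i + 1 : ℕ) * r) *
            ((Equiv.funSplitAt i0 (Fin (2 ^ r'))).symm (x, y) i : ℕ) =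
            ∑ i ∈ Finset.univ.erase i0, 2 ^ ((i + 1 : ℕ) * r) * (E0 i : ℕ) := by
          refine Finset.sum_congr rfl fun i hi => ?_
          have : i ≠ i0 := Finset.ne_of_mem_erase hi
          simp [hE0, Equiv.funSplitAt, Equiv.piSplitAt, this]
        rw [a1]
        have a2 : ((Equiv.funSplitAt i0 (Fin (2 ^ r'))).symm (x, y) i0) = x := by
          simp [Equiv.funSplitAt, Equiv.piSplitAt]
        have a3 : (E0 i0 : ℕ) = 0 := by
          simp [hE0, Equiv.funSplitAt, Equiv.piSplitAt]
        rw [a2, a3]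
        have : (i0 : ℕ) + 1 = w := by simp [hi0]; omega
        rw [this]; ring
      simp only [key]
      rw [Finset.sum_comm]
      rw [Fin.sum_univ_eq_sum_range (fun j => ∑ x : Fin (2 ^ r'),
        χ ((2 * j + 1 + 2 * E' + 2 ^ (w * r) * x : ℕ) : ZMod (2 ^ (K * r))))]
      refine inner_bound χ hm h1 h2 ?_ ?_ ?_ E'
      · exact Nat.mul_pos hw1 hrpos
      · omega
      · omega
    refine (norm_sum_le _ _).trans ((Finset.sum_le_sum fun y _ => hb y).trans ?_)
    rw [Finset.sum_const, Finset.card_univ, card_Ix, le_div_iff₀ hs]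
    have hc : Fintype.card ({j // j ≠ i0} → Fin (2 ^ r')) = (2 ^ r') ^ (K - 1) := by simp
    rw [hc, nsmul_eq_mul]
    have := Real.mul_self_sqrt (by positivity : (0 : ℝ) ≤ 2 ^ r')
    push_cast
    calc _ = ((2 : ℝ) ^ r') ^ (K - 1) * 2 ^ (2 * r - 1) * (√(2 ^ r') * √(2 ^ r')) := by ring
      _ = 2 ^ (2 * r - 1) * ((2 ^ r') ^ (K - 1) * 2 ^ r') := by rw [this]; ring
      _ = 2 ^ (2 * r - 1) * (2 ^ r') ^ K := by rw [← pow_succ, Nat.sub_add_cancel hK]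
      _ ≤ _ := le_rfl


lemma count_class' (q : ℕ) [NeZero q] (y : ℕ) (a : ZMod q) :
    ((y / q : ℕ) : ℝ) ≤ ∑ e ∈ Finset.range y, (if a = (e : ZMod q) then (1 : ℝ) else 0) ∧
    ∑ e ∈ Finset.range y, (if a = (e : ZMod q) then (1 : ℝ) else 0) ≤ ((y / q : ℕ) : ℝ) + 1 := by
  have hq : 0 < q := Nat.pos_of_ne_zero (NeZero.ne q)
  have h := Nat.count_modEq_card y hq a.val
  rw [Nat.count_eq_card_filter_range] at h
  have e : ∑ m ∈ Finset.range y, (if a = (m : ZMod q) then (1 : ℝ) else 0) =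
      ((Finset.range y).filter (fun m => m ≡ a.val [MOD q])).card := by
    rw [Finset.sum_ite, Finset.sum_const_zero, add_zero, Finset.sum_const, nsmul_eq_mul, mul_one]
    congr 2
    ext m
    simp only [Finset.mem_filter, ← ZMod.natCast_eq_natCast_iff, ZMod.natCast_zmod_val]
    exact and_congr_right fun _ => ⟨fun h => h.symm, fun h => h.symm⟩
  rw [e, h]
  push_cast
  split_ifs <;> simp

lemma Wt_nonneg {ι : Type} [Fintype ι] (q : ℕ) (b : ι → ZMod q) (n : ℕ) : 0 ≤ Wt q b n :=
  Finset.sum_nonneg fun _ _ => by split_ifs <;> simp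

lemma Wt_le {ι : Type} [Fintype ι] (q : ℕ) (b : ι → ZMod q) (n : ℕ) :
    Wt q b n ≤ Fintype.card ι := by
  unfold Wt
  calc _ ≤ ∑ i : ι, (1 : ℝ) := Finset.sum_le_sum fun _ _ => by split_ifs <;> simp
    _ = _ := by simp

lemma Wt_nonunit {ι : Type} [Fintype ι] (q : ℕ) (b : ι → ZMod q) (hb : ∀ i, IsUnit (b i)) (n : ℕ)
    (hn : ¬ IsUnit (n : ZMod q)) : Wt q b n = 0 := by
  unfold Wt
  refine Finset.sum_eq_zero fun i _ => if_neg ?_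
  intro h; exact hn (h ▸ hb i)

lemma Dl_nonunit {ι : Type} [Fintype ι] (q : ℕ) (b : ι → ZMod q) (hb : ∀ i, IsUnit (b i)) (n : ℕ)
    (hn : ¬ IsUnit (n : ZMod q)) : Dl q b n = 0 := by
  unfold Dl
  rw [Wt_nonunit q b hb n hn, if_neg hn]; simp

lemma type_one {ι : Type} [Fintype ι] (q : ℕ) [NeZero q] (b : ι → ZMod q)
    (hb : ∀ i, IsUnit (b i)) (D y : ℕ) :
    |∑ e ∈ Finset.range y, Dl q b (D * e)| ≤ Fintype.card ι := by
  classical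
  have hφ : (0 : ℝ) < q.totient := by
    exact_mod_cast (Nat.totient_pos.2 (Nat.pos_of_ne_zero (NeZero.ne q)))
  by_cases hD : IsUnit (D : ZMod q)
  · set N : ℝ := ((y / q : ℕ) : ℝ)
    have hW : ∑ e ∈ Finset.range y, Wt q b (D * e) =
        ∑ i, ∑ e ∈ Finset.range y, (if (D : ZMod q)⁻¹ * b i = (e : ZMod q) then (1 : ℝ) else 0) := by
      unfold Wt
      rw [Finset.sum_comm]
      refine Finset.sum_congr rfl fun i _ => Finset.sum_congr rfl fun e _ => ?_
      have : b i = ((D * e : ℕ) : ZMod q) ↔ (D : ZMod q)⁻¹ * b i = (e : ZMod q) := by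
        push_cast
        constructor
        · intro h; rw [h, ← mul_assoc, ZMod.inv_mul_of_unit _ hD, one_mul]
        · intro h; rw [← h, ← mul_assoc, ZMod.mul_inv_of_unit _ hD, one_mul]
      simp only [this]
    have hU : ∑ e ∈ Finset.range y, (if IsUnit ((D * e : ℕ) : ZMod q) then (1 : ℝ) else 0) =
        ∑ u : (ZMod q)ˣ, ∑ e ∈ Finset.range y,
          (if (u : ZMod q) = (e : ZMod q) then (1 : ℝ) else 0) := by
      rw [Finset.sum_comm]
      refine Finset.sum_congr rfl fun e _ => ?_
      have : IsUnit ((D * e : ℕ) : ZMod q) ↔ IsUnit (e : ZMod q) := by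
        push_cast; rw [IsUnit.mul_iff]; simp [hD]
      simp only [this]
      split_ifs with h
      · obtain ⟨u, hu⟩ := h
        rw [Finset.sum_eq_single u]
        · simp [hu]
        · intro v _ hv
          rw [if_neg]
          rw [← hu]; exact fun h => hv (Units.ext h)
        · intro h; exact absurd (Finset.mem_univ _) h
      · symm
        refine Finset.sum_eq_zero fun u _ => if_neg ?_
        intro hh; exact h (hh ▸ u.isUnit)
    have hW1 : Fintype.card ι * N ≤ ∑ e ∈ Finset.range y, Wt q b (D * e) := by
      rw [hW]
      calc _ = ∑ i : ι, N := by simp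
        _ ≤ _ := Finset.sum_le_sum fun i _ => (count_class' q y _).1
    have hW2 : ∑ e ∈ Finset.range y, Wt q b (D * e) ≤ Fintype.card ι * (N + 1) := by
      rw [hW]
      calc _ ≤ ∑ i : ι, (N + 1) := Finset.sum_le_sum fun i _ => (count_class' q y _).2
        _ = _ := by simp; ring
    have hU1 : q.totient * N ≤ ∑ e ∈ Finset.range y,
        (if IsUnit ((D * e : ℕ) : ZMod q) then (1 : ℝ) else 0) := by
      rw [hU]
      calc _ = ∑ i : (ZMod q)ˣ, N := by simp [ZMod.card_units_eq_totient]
        _ ≤ _ := Finset.sum_le_sum fun i _ => (count_class' q y _).1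
    have hU2 : ∑ e ∈ Finset.range y,
        (if IsUnit ((D * e : ℕ) : ZMod q) then (1 : ℝ) else 0) ≤ q.totient * (N + 1) := by
      rw [hU]
      calc _ ≤ ∑ i : (ZMod q)ˣ, (N + 1) := Finset.sum_le_sum fun i _ => (count_class' q y _).2
        _ = _ := by simp [ZMod.card_units_eq_totient]; ring
    have hs : ∑ e ∈ Finset.range y, Dl q b (D * e) = ∑ e ∈ Finset.range y, Wt q b (D * e) -
       (Fintype.card ι / q.totient : ℝ) * ∑ e ∈ Finset.range y,
        (if IsUnit ((D * e : ℕ) : ZMod q) then (1 : ℝ) else 0) := by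
      rw [Finset.mul_sum, ← Finset.sum_sub_distrib]
      refine Finset.sum_congr rfl fun e _ => ?_
      unfold Dl
      congr 2
      split_ifs <;> rfl
    have hc : (0 : ℝ) ≤ Fintype.card ι / q.totient := by positivity
    have a1 := mul_le_mul_of_nonneg_left hU1 hc
    have a2 := mul_le_mul_of_nonneg_left hU2 hc
    have b1 : (Fintype.card ι / q.totient : ℝ) * (q.totient * N) = Fintype.card ι * N := by
      field_simp
    have b2 : (Fintype.card ι / q.totient : ℝ) * (q.totient * (N + 1)) =
      Fintype.card ι * (N + 1) := by field_simp
    rw [b1] at a1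
    rw [b2] at a2
    rw [hs, abs_le]
    constructor <;> linarith
  · have : ∑ e ∈ Finset.range y, Dl q b (D * e) = 0 := by
      refine Finset.sum_eq_zero fun e _ => Dl_nonunit q b hb _ ?_
      push_cast; rw [IsUnit.mul_iff]; exact fun h => hD h.1
    rw [this, abs_zero]; positivity


open ArithmeticFunction in
abbrev mu (n : ℕ) : ℝ := ((ArithmeticFunction.moebius n : ℤ) : ℝ)

def sift (z N : ℕ) : Prop := ∀ p, p.Prime → p < z → ¬ p ∣ N

open Classical in
noncomputable def Sm (z N : ℕ) : Finset ℕ :=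
  N.divisors.filter (fun d => Squarefree d ∧ ∀ p, p.Prime → p ∣ d → p < z)

lemma mu_prime_mul {p d : ℕ} (hp : p.Prime) (hd : ¬ p ∣ d) : mu (p * d) = - mu d := by
  unfold mu
  rw [ArithmeticFunction.isMultiplicative_moebius.map_mul_of_coprime
    ((Nat.Prime.coprime_iff_not_dvd hp).2 hd), ArithmeticFunction.moebius_apply_prime hp]
  push_cast; ring

open Classical in
lemma sieve_id (z N Y c : ℕ) (hN : 1 ≤ N) (hc : 1 ≤ c) (hcY : c < Y) :
    (if sift z N then (1 : ℝ) else 0) =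
      ∑ d ∈ Sm z N, (if c * d < Y then mu d else 0) +
      ∑ d ∈ Sm z N, (if Y ≤ c * d ∧ c * (d / d.minFac) < Y ∧ sift d.minFac (N / d)
        then mu d else 0) := by
  rw [← Finset.sum_add_distrib]
  by_cases hs : sift z N
  · have : Sm z N = {1} := by
      ext d
      simp only [Sm, Finset.mem_filter, Nat.mem_divisors, Finset.mem_singleton]
      constructor
      · rintro ⟨⟨hdN, _⟩, _, hp⟩
        by_contra hd
        have := Nat.minFac_prime hd
        exact hs _ this (hp _ this (Nat.minFac_dvd d)) ((Nat.minFac_dvd d).trans hdN)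
      · rintro rfl
        exact ⟨⟨one_dvd _, by omega⟩, squarefree_one, fun p hp h => by
          have := Nat.dvd_one.1 h; exact absurd this hp.one_lt.ne'⟩
    rw [this, Finset.sum_singleton, if_pos hs]
    have h1 : c * 1 < Y := by omega
    have h2 : ¬ (Y ≤ c * 1 ∧ c * (1 / Nat.minFac 1) < Y ∧ sift (Nat.minFac 1) (N / 1)) := by
      intro h; omega
    rw [if_pos h1, if_neg h2]; simp [mu]
  · rw [if_neg hs]
    have hN1 : N ≠ 1 := by
      rintro rfl
      refine hs fun p hp _ h => ?_
      have := Nat.dvd_one.1 h; exact absurd this hp.one_lt.ne'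
    set P := N.minFac with hPdef
    have hP : P.Prime := Nat.minFac_prime hN1
    have hPN : P ∣ N := Nat.minFac_dvd N
    have hPz : P < z := by
      by_contra h
      refine hs fun p hp hpz hpN => ?_
      have := Nat.minFac_le_of_dvd hp.two_le hpN
      omega
    have F1 : ∀ d ∈ Sm z N, ¬ P ∣ d →
        ((if c * d < Y then mu d else 0) + (if Y ≤ c * d ∧ c * (d / d.minFac) < Y ∧
          sift d.minFac (N / d) then mu d else 0)) = if c * d < Y then mu d else 0 := by
      intro d hd hPd
      simp only [Sm, Finset.mem_filter, Nat.mem_divisors] at hd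
      rw [if_neg (c := Y ≤ c * d ∧ c * (d / d.minFac) < Y ∧ sift d.minFac (N / d)), add_zero]
      rintro ⟨h1, _, h3⟩
      have hd1 : d ≠ 1 := by rintro rfl; omega
      have hmf := Nat.minFac_prime hd1
      have hle : P ≤ d.minFac :=
        Nat.minFac_le_of_dvd hmf.two_le ((Nat.minFac_dvd d).trans hd.1.1)
      have hne : P ≠ d.minFac := fun h => hPd (h ▸ Nat.minFac_dvd d)
      refine h3 P hP (by omega) ?_
      obtain ⟨e, he⟩ := hd.1.1
      have hd0 : 0 < d := Nat.pos_of_ne_zero (by rintro rfl; simp at he; omega)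
      rw [he, Nat.mul_div_cancel_left _ hd0]
      rw [he] at hPN
      exact (hP.dvd_mul.1 hPN).resolve_left hPd
    have F2 : ∀ d, P * d ∈ Sm z N → ¬ P ∣ d → 
        ((if c * (P * d) < Y then mu (P * d) else 0) + (if Y ≤ c * (P * d) ∧
          c * ((P * d) / (P * d).minFac) < Y ∧
          sift (P * d).minFac (N / (P * d)) then mu (P * d) else 0)) =
          - if c * d < Y then mu d else 0 := by
      intro d hd hPd
      simp only [Sm, Finset.mem_filter, Nat.mem_divisors] at hd
      have hmf : (P * d).minFac = P := by
        apply le_antisymm (Nat.minFac_le_of_dvd hP.two_le (dvd_mul_right _ _))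
        have h1 : P * d ≠ 1 := fun h => hP.one_lt.ne' (Nat.eq_one_of_mul_eq_one_right h)
        exact Nat.minFac_le_of_dvd (Nat.minFac_prime h1).two_le
          ((Nat.minFac_dvd _).trans hd.1.1)
      have hsft : sift P (N / (P * d)) := by
        intro p hp hpP hpd
        have : p ∣ N := hpd.trans (Nat.div_dvd_of_dvd hd.1.1)
        have := Nat.minFac_le_of_dvd hp.two_le this
        omega
      rw [hmf, Nat.mul_div_cancel_left _ hP.pos, mu_prime_mul hP hPd]
      have hle : c * d ≤ c * (P * d) := Nat.mul_le_mul_left _ (Nat.le_mul_of_pos_left _ hP.pos)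
      by_cases h1 : c * (P * d) < Y
      · have h2 : c * d < Y := by omega
        have h3 : ¬ (Y ≤ c * (P * d) ∧ c * d < Y ∧ sift P (N / (P * d))) := by
          intro h; omega
        rw [if_pos h1, if_pos h2, if_neg h3]; ring
      · by_cases h2 : c * d < Y
        · have h3 : (Y ≤ c * (P * d) ∧ c * d < Y ∧ sift P (N / (P * d))) :=
            ⟨by omega, h2, hsft⟩
          rw [if_neg h1, if_pos h2, if_pos h3]; ring
        · have h3 : ¬ (Y ≤ c * (P * d) ∧ c * d < Y ∧ sift P (N / (P * d))) := by
            intro h; omega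
          rw [if_neg h1, if_neg h2, if_neg h3]; ring
    have mem1 : ∀ d, P * d ∈ Sm z N → d ∈ Sm z N ∧ ¬ P ∣ d := by
      intro d hd
      simp only [Sm, Finset.mem_filter, Nat.mem_divisors] at hd ⊢
      refine ⟨⟨⟨(dvd_mul_left _ _).trans hd.1.1, hd.1.2⟩,
        hd.2.1.squarefree_of_dvd (dvd_mul_left _ _),
        fun p hp h => hd.2.2 p hp (h.trans (dvd_mul_left _ _))⟩, ?_⟩
      rintro ⟨e, rfl⟩
      have := hd.2.1 P ⟨e, by ring⟩
      exact hP.one_lt.ne' (Nat.isUnit_iff.1 this)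
    have mem2 : ∀ d, d ∈ Sm z N → ¬ P ∣ d → P * d ∈ Sm z N := by
      intro d hd hPd
      simp only [Sm, Finset.mem_filter, Nat.mem_divisors] at hd ⊢
      have hcop : Nat.Coprime P d := (Nat.Prime.coprime_iff_not_dvd hP).2 hPd
      refine ⟨⟨hcop.mul_dvd_of_dvd_of_dvd hPN hd.1.1, hd.1.2⟩,
        (Nat.squarefree_mul hcop).2 ⟨hP.squarefree, hd.2.1⟩, fun p hp h => ?_⟩
      rcases hp.dvd_mul.1 h with h | h
      · rw [(Nat.prime_dvd_prime_iff_eq hp hP).1 h]; exact hPz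
      · exact hd.2.2 p hp h
    symm
    refine Finset.sum_involution (fun d _ => if P ∣ d then d / P else P * d) ?_ ?_ ?_ ?_
    · intro d hd
      by_cases hPd : P ∣ d
      · obtain ⟨e, rfl⟩ := hPd
        obtain ⟨m1, m2⟩ := mem1 e hd
        simp only [dvd_mul_right, if_true, Nat.mul_div_cancel_left _ hP.pos]
        rw [F2 e hd m2, F1 e m1 m2]; ring
      · simp only [hPd, if_false]
        rw [F1 d hd hPd, F2 d (mem2 d hd hPd) hPd]; ring
    · intro d hd _ h
      by_cases hPd : P ∣ d
      · obtain ⟨e, rfl⟩ := hPd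
        simp only [dvd_mul_right, if_true, Nat.mul_div_cancel_left _ hP.pos] at h
        apply (mem1 e hd).2
        exact h ▸ dvd_mul_right _ _
      · simp only [hPd, if_false] at h
        exact hPd (h ▸ dvd_mul_right _ _)
    · intro d hd
      by_cases hPd : P ∣ d
      · obtain ⟨e, rfl⟩ := hPd
        simp only [dvd_mul_right, if_true, Nat.mul_div_cancel_left _ hP.pos]
        exact (mem1 e hd).1
      · simp only [hPd, if_false]
        exact mem2 d hd hPd
    · intro d hd
      by_cases hPd : P ∣ d
      · obtain ⟨e, rfl⟩ := hPd
        simp only [dvd_mul_right, if_true, Nat.mul_div_cancel_left _ hP.pos, (mem1 e hd).2,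
          if_false]
      · simp only [hPd, if_false, dvd_mul_right, if_true, Nat.mul_div_cancel_left _ hP.pos]


lemma sqrt_aux {q M N : ℝ} (hq : 0 < q) (hM : q ≤ M) (hN : q ≤ N) :
    √(M / q + 1) * √(N / q + 1) ≤ 2 * √(M * N) / q := by
  have h1 : M / q + 1 ≤ 2 * M / q := by
    rw [le_div_iff₀ hq, add_mul, div_mul_cancel₀ _ hq.ne']; linarith
  have h2 : N / q + 1 ≤ 2 * N / q := by
    rw [le_div_iff₀ hq, add_mul, div_mul_cancel₀ _ hq.ne']; linarith
  have hM0 : 0 ≤ M := by linarith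
  have hN0 : 0 ≤ N := by linarith
  calc √(M / q + 1) * √(N / q + 1) ≤ √(2 * M / q) * √(2 * N / q) := by gcongr
    _ = √((2 * M / q) * (2 * N / q)) := by rw [Real.sqrt_mul (by positivity)]
    _ = √((2 / q) ^ 2 * (M * N)) := by congr 1; field_simp
    _ = 2 / q * √(M * N) := by
      rw [Real.sqrt_mul (by positivity), Real.sqrt_sq (by positivity)]
    _ = _ := by ring

lemma type_two_block {ι : Type} [Fintype ι] (k L : ℕ) (b : ι → ZMod (2 ^ k))
    (hb : ∀ i, IsUnit (b i)) (σ : ℝ) (hσ0 : 0 ≤ σ)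
    (hσ : ∀ χ : DirichletCharacter ℂ (2 ^ k), χ ≠ 1 → ‖∑ i, χ (b i)‖ ≤ σ)
    (α β : ℕ → ℝ) (A : ℝ) (hA0 : 0 ≤ A) (hA : ∀ m, |α m| ≤ A) (hβ : ∀ e, |β e| ≤ 1)
    (hβ0 : β 0 = 0)
    (u v : ℕ → ℕ) (hu : ∀ m < 2 ^ L, u m < 2 ^ (L + 1)) (hv : ∀ e < 2 ^ L, v e + 1 < 2 ^ (L + 1))
    (i : ℕ) (hi : k ≤ i) (hiL : i + k < L) (hα : ∀ m, Nat.log 2 m ≠ i → α m = 0) (hL : 1 ≤ k) :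
    |∑ m ∈ Finset.range (2 ^ L), ∑ e ∈ Finset.range (2 ^ L), α m * β e *
      (if m * e < 2 ^ L ∧ u m ≤ v e then Dl (2 ^ k) b (m * e) else 0)| ≤
    (L + 1) ^ 2 * (4 * σ * A * 2 ^ L / 2 ^ k) := by
  have hrange : ∀ m, α m ≠ 0 → 2 ^ i ≤ m ∧ m < 2 ^ (i + 1) := by
    intro m hm
    have hlog : Nat.log 2 m = i := by by_contra h; exact hm (hα m h)
    have hm0 : m ≠ 0 := by
      rintro rfl
      simp at hlog; omega
    exact ⟨hlog ▸ Nat.pow_log_le_self 2 hm0, hlog ▸ Nat.lt_pow_succ_log_self (by norm_num) m⟩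
  have hpow : (2 : ℕ) ^ L = 2 ^ i * 2 ^ (L - i) := by rw [← pow_add]; congr 1; omega
  have e1 : ∑ m ∈ Finset.range (2 ^ L), ∑ e ∈ Finset.range (2 ^ L), α m * β e *
      (if m * e < 2 ^ L ∧ u m ≤ v e then Dl (2 ^ k) b (m * e) else 0) =
      ∑ m ∈ Finset.range (2 ^ (i + 1)), ∑ e ∈ Finset.range (2 ^ (L - i)), α m * β e *
      (if u m < v e + 1 then (if m < (2 ^ L - 1) / e + 1 then Dl (2 ^ k) b (m * e) else 0)
        else 0) := by
    have s1 : Finset.range (2 ^ (i + 1)) ⊆ Finset.range (2 ^ L) :=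
      Finset.range_subset_range.2 (Nat.pow_le_pow_right (by norm_num) (by omega))
    have s2 : Finset.range (2 ^ (L - i)) ⊆ Finset.range (2 ^ L) :=
      Finset.range_subset_range.2 (Nat.pow_le_pow_right (by norm_num) (by omega))
    symm
    rw [← Finset.sum_subset s1 (by
      intro m _ hm
      refine Finset.sum_eq_zero fun e _ => ?_
      have : α m = 0 := by
        by_contra h; exact hm (Finset.mem_range.2 (hrange m h).2)
      simp [this])]
    refine Finset.sum_congr rfl fun m hm => ?_
    by_cases hαm : α m = 0
    · simp [hαm]
    have hm1 := (hrange m hαm).1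
    rw [← Finset.sum_subset s2 (by
      intro e _ he
      rw [if_neg, mul_zero]
      rintro ⟨h, _⟩
      apply he
      rw [Finset.mem_range]
      have : 2 ^ i * e < 2 ^ i * 2 ^ (L - i) := by
        rw [← hpow]; exact lt_of_le_of_lt (Nat.mul_le_mul_right _ hm1) h
      exact lt_of_mul_lt_mul_left this (Nat.zero_le _))]
    refine Finset.sum_congr rfl fun e he => ?_
    by_cases he0 : e = 0
    · rw [he0, hβ0]; simp
    congr 1
    have hx : 0 < 2 ^ L := by positivity
    have : m * e < 2 ^ L ↔ m < (2 ^ L - 1) / e + 1 := by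
      rw [Nat.lt_succ_iff, Nat.le_div_iff_mul_le (by omega)]; omega
    have h2 : u m < v e + 1 ↔ u m ≤ v e := Nat.lt_succ_iff
    by_cases c1 : m * e < 2 ^ L <;> by_cases c2 : u m ≤ v e
    · rw [if_pos (h2.2 c2), if_pos (this.1 c1), if_pos ⟨c1, c2⟩]
    · rw [if_neg (fun h => c2 (h2.1 h)), if_neg (fun h => c2 h.2)]
    · rw [if_pos (h2.2 c2), if_neg (fun h => c1 (this.2 h)), if_neg (fun h => c1 h.1)]
    · rw [if_neg (fun h => c2 (h2.1 h)), if_neg (fun h => c2 h.2)]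
  rw [e1]
  have hq : (0 : ℝ) < ((2 ^ k : ℕ) : ℝ) := by positivity
  have B0 := Dl_BF (2 ^ k) b hb σ hσ0 hσ (2 ^ (i + 1)) (2 ^ (L - i))
  have B1 := BF_couple (by positivity) B0 (L + 1) (fun m => m) (fun e => (2 ^ L - 1) / e + 1)
    (by
      intro m hm
      exact lt_of_lt_of_le (Finset.mem_range.1 hm) (Nat.pow_le_pow_right (by norm_num) (by omega)))
    (by
      intro e _
      have h1 : (2 ^ L - 1) / e ≤ 2 ^ L - 1 := Nat.div_le_self _ _
      have hx : 0 < 2 ^ L := by positivity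
      have : 2 ^ (L + 1) = 2 ^ L * 2 := pow_succ _ _
      show (2 ^ L - 1) / e + 1 < _
      omega)
  have B2 := BF_couple (by positivity) B1 (L + 1) u (fun e => v e + 1)
    (by
      intro m hm
      exact hu m (lt_of_lt_of_le (Finset.mem_range.1 hm)
        (Nat.pow_le_pow_right (by norm_num) (by omega))))
    (by
      intro e he
      exact hv e (lt_of_lt_of_le (Finset.mem_range.1 he)
        (Nat.pow_le_pow_right (by norm_num) (by omega))))
  refine (B2 α β).trans ?_
  have n1 : √(∑ m ∈ Finset.range (2 ^ (i + 1)), α m ^ 2) ≤ A * √(2 ^ (i + 1)) := by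
    rw [← Real.sqrt_sq hA0, ← Real.sqrt_mul (by positivity)]
    apply Real.sqrt_le_sqrt
    calc _ ≤ ∑ m ∈ Finset.range (2 ^ (i + 1)), A ^ 2 := by
          refine Finset.sum_le_sum fun m _ => ?_
          rw [← sq_abs]; gcongr; exact hA m
      _ = _ := by simp; ring
  have n2 : √(∑ e ∈ Finset.range (2 ^ (L - i)), β e ^ 2) ≤ √(2 ^ (L - i)) := by
    apply Real.sqrt_le_sqrt
    calc _ ≤ ∑ e ∈ Finset.range (2 ^ (L - i)), (1 : ℝ) := by
          refine Finset.sum_le_sum fun e _ => ?_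
          rw [← sq_abs]; exact pow_le_one₀ (abs_nonneg _) (hβ e)
      _ = _ := by simp
  have n3 := sqrt_aux (q := ((2 ^ k : ℕ) : ℝ)) (M := ((2 ^ (i + 1) : ℕ) : ℝ))
    (N := ((2 ^ (L - i) : ℕ) : ℝ)) hq
    (by exact_mod_cast Nat.pow_le_pow_right (by norm_num) (by omega))
    (by exact_mod_cast Nat.pow_le_pow_right (by norm_num) (by omega))
  have n4 : √((2 : ℝ) ^ (i + 1)) * √(2 ^ (L - i)) = √(2 * 2 ^ L) := by
    rw [← Real.sqrt_mul (by positivity)]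
    congr 1
    rw [← pow_add, ← pow_succ']; congr 1; omega
  have n5 : √((2 : ℝ) * 2 ^ L) * √(2 * 2 ^ L) = 2 * 2 ^ L := Real.mul_self_sqrt (by positivity)
  have n6 : (((2 ^ (i + 1) : ℕ) : ℝ)) * ((2 ^ (L - i) : ℕ) : ℝ) = 2 * 2 ^ L := by
    push_cast
    rw [← pow_add, ← pow_succ']; congr 1; omega
  rw [n6] at n3
  calc _ ≤ ((L + 1 : ℕ) : ℝ) * (((L + 1 : ℕ) : ℝ) *
        (σ * (2 * √(2 * 2 ^ L) / ((2 ^ k : ℕ) : ℝ)))) *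
        ((A * √(2 ^ (i + 1))) * √(2 ^ (L - i))) := by gcongr
    _ = (L + 1) ^ 2 * (σ * A * 2 / 2 ^ k * (√(2 * 2 ^ L) * (√(2 ^ (i + 1)) * √(2 ^ (L - i))))) := by
      push_cast; ring
    _ = _ := by rw [n4, n5]; ring

lemma type_two {ι : Type} [Fintype ι] (k L : ℕ) (b : ι → ZMod (2 ^ k))
    (hb : ∀ i, IsUnit (b i)) (σ : ℝ) (hσ0 : 0 ≤ σ)
    (hσ : ∀ χ : DirichletCharacter ℂ (2 ^ k), χ ≠ 1 → ‖∑ i, χ (b i)‖ ≤ σ)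
    (α β : ℕ → ℝ) (A : ℝ) (hA0 : 0 ≤ A) (hA : ∀ m, |α m| ≤ A) (hβ : ∀ e, |β e| ≤ 1)
    (hβ0 : β 0 = 0)
    (u v : ℕ → ℕ) (hu : ∀ m < 2 ^ L, u m < 2 ^ (L + 1)) (hv : ∀ e < 2 ^ L, v e + 1 < 2 ^ (L + 1))
    (hk : 1 ≤ k) (hkL : 2 * k ≤ L)
    (hα : ∀ m, α m ≠ 0 → 2 ^ k ≤ m ∧ m < 2 ^ (L - k)) :
    |∑ m ∈ Finset.range (2 ^ L), ∑ e ∈ Finset.range (2 ^ L), α m * β e *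
      (if m * e < 2 ^ L ∧ u m ≤ v e then Dl (2 ^ k) b (m * e) else 0)| ≤
    (L + 1) ^ 3 * (4 * σ * A * 2 ^ L / 2 ^ k) := by
  have dec : ∀ m, α m = ∑ i ∈ Finset.Ico k (L - k), (if Nat.log 2 m = i then α m else 0) := by
    intro m
    by_cases h : α m = 0
    · simp [h]
    · rw [Finset.sum_ite_eq, if_pos]
      obtain ⟨h1, h2⟩ := hα m h
      have hm0 : m ≠ 0 := by have : 0 < 2 ^ k := by positivity
                             omega
      rw [Finset.mem_Ico]
      exact ⟨(Nat.le_log_iff_pow_le (by norm_num) hm0).2 h1,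
        (Nat.log_lt_iff_lt_pow (by norm_num) hm0).2 h2⟩
  have e1 : ∑ m ∈ Finset.range (2 ^ L), ∑ e ∈ Finset.range (2 ^ L), α m * β e *
      (if m * e < 2 ^ L ∧ u m ≤ v e then Dl (2 ^ k) b (m * e) else 0) =
      ∑ i ∈ Finset.Ico k (L - k), ∑ m ∈ Finset.range (2 ^ L), ∑ e ∈ Finset.range (2 ^ L),
      (if Nat.log 2 m = i then α m else 0) * β e *
      (if m * e < 2 ^ L ∧ u m ≤ v e then Dl (2 ^ k) b (m * e) else 0) := by
    symm
    rw [Finset.sum_comm]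
    refine Finset.sum_congr rfl fun m _ => ?_
    rw [Finset.sum_comm]
    refine Finset.sum_congr rfl fun e _ => ?_
    rw [← Finset.sum_mul, ← Finset.sum_mul, ← dec]
  rw [e1]
  refine (Finset.abs_sum_le_sum_abs _ _).trans ?_
  have : ∀ i ∈ Finset.Ico k (L - k), |∑ m ∈ Finset.range (2 ^ L), ∑ e ∈ Finset.range (2 ^ L),
      (if Nat.log 2 m = i then α m else 0) * β e *
      (if m * e < 2 ^ L ∧ u m ≤ v e then Dl (2 ^ k) b (m * e) else 0)| ≤
      (L + 1) ^ 2 * (4 * σ * A * 2 ^ L / 2 ^ k) := by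
    intro i hi
    rw [Finset.mem_Ico] at hi
    refine type_two_block k L b hb σ hσ0 hσ _ β A hA0 ?_ hβ hβ0 u v hu hv i hi.1 (by omega) ?_ hk
    · intro m; split_ifs
      · exact hA m
      · simpa using hA0
    · intro m hm; rw [if_neg hm]
  refine (Finset.sum_le_sum this).trans ?_
  rw [Finset.sum_const, nsmul_eq_mul, Nat.card_Ico]
  have h0 : (0 : ℝ) ≤ (L + 1) ^ 2 * (4 * σ * A * 2 ^ L / 2 ^ k) := by positivity
  have h1 : ((L - k - k : ℕ) : ℝ) ≤ L + 1 := by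
    have : L - k - k ≤ L + 1 := by omega
    exact_mod_cast this
  calc _ ≤ ((L : ℝ) + 1) * ((L + 1) ^ 2 * (4 * σ * A * 2 ^ L / 2 ^ k)) := by gcongr
    _ = _ := by ring


lemma reindex (c x : ℕ) (hc : 1 ≤ c) (h : ℕ → ℕ → ℝ) :
    ∑ N ∈ (Finset.range x).filter (fun N => 1 ≤ N ∧ c * N < x), ∑ d ∈ N.divisors,
      h (c * d) (N / d) =
    ∑ m ∈ Finset.range x, ∑ e ∈ Finset.range x,
      if 1 ≤ m ∧ 1 ≤ e ∧ m * e < x ∧ c ∣ m then h m e else 0 := by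
  rw [← Finset.sum_product', ← Finset.sum_filter, Finset.sum_sigma']
  refine Finset.sum_bij' (fun p _ => (c * p.2, p.1 / p.2))
    (fun p _ => ⟨p.1 / c * p.2, p.1 / c⟩) ?_ ?_ ?_ ?_ ?_
  · rintro ⟨N, d⟩ hp
    simp only [Finset.mem_sigma, Finset.mem_filter, Finset.mem_range, Nat.mem_divisors,
      Finset.mem_product] at hp ⊢
    obtain ⟨⟨h1, h2, h3⟩, ⟨e, rfl⟩, h5⟩ := hp
    have hd : 0 < d := Nat.pos_of_ne_zero (by rintro rfl; simp at h5)
    have he : 0 < e := Nat.pos_of_ne_zero (by rintro rfl; simp at h5)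
    rw [Nat.mul_div_cancel_left _ hd]
    rw [← mul_assoc] at h3
    have g1 : c * d ≤ c * d * e := Nat.le_mul_of_pos_right _ he
    have g2 : e ≤ d * e := Nat.le_mul_of_pos_left _ hd
    exact ⟨⟨by omega, by omega⟩, Nat.mul_pos hc hd, he, h3, dvd_mul_right _ _⟩
  · rintro ⟨m, e⟩ hp
    simp only [Finset.mem_sigma, Finset.mem_filter, Finset.mem_range, Nat.mem_divisors,
      Finset.mem_product] at hp ⊢
    obtain ⟨⟨h1, h2⟩, h3, h4, h5, ⟨d, rfl⟩⟩ := hp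
    rw [Nat.mul_div_cancel_left _ hc]
    have hd : 0 < d := Nat.pos_of_ne_zero (by rintro rfl; simp at h3)
    have : d * e ≤ c * (d * e) := Nat.le_mul_of_pos_left _ hc
    rw [mul_assoc] at h5
    exact ⟨⟨by omega, Nat.mul_pos hd h4, h5⟩, dvd_mul_right _ _, (Nat.mul_pos hd h4).ne'⟩
  · rintro ⟨N, d⟩ hp
    simp only [Finset.mem_sigma, Finset.mem_filter, Finset.mem_range, Nat.mem_divisors] at hp
    obtain ⟨⟨h1, h2, h3⟩, ⟨e, rfl⟩, h5⟩ := hp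
    have hd : 0 < d := Nat.pos_of_ne_zero (by rintro rfl; simp at h5)
    simp [Nat.mul_div_cancel_left _ hd, Nat.mul_div_cancel_left _ hc]
  · rintro ⟨m, e⟩ hp
    simp only [Finset.mem_filter, Finset.mem_product] at hp
    obtain ⟨_, h3, h4, h5, ⟨d, rfl⟩⟩ := hp
    have hd : 0 < d := Nat.pos_of_ne_zero (by rintro rfl; simp at h3)
    simp [Nat.mul_div_cancel_left _ hd, Nat.mul_div_cancel_left _ hc]
  · rintro ⟨N, d⟩ hp
    rfl

lemma abs_mu_le (n : ℕ) : |mu n| ≤ 1 := by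
  unfold mu
  exact_mod_cast ArithmeticFunction.abs_moebius_le_one (n := n)

lemma card_Q_dvd (Q : Finset ℕ) (z : ℕ) (hQ : ∀ c ∈ Q, c = 1 ∨ (c.Prime ∧ z ≤ c)) (L m : ℕ)
    (hm : 1 ≤ m) (hmL : m < 2 ^ L) :
    ((Q.filter (fun c => c ∣ m)).card : ℝ) ≤ L + 1 := by
  have h1 : Q.filter (fun c => c ∣ m) ⊆ insert 1 m.primeFactors := by
    intro c hc
    rw [Finset.mem_filter] at hc
    rw [Finset.mem_insert, Nat.mem_primeFactors]
    rcases hQ c hc.1 with h | h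
    · exact Or.inl h
    · exact Or.inr ⟨h.1, hc.2, by omega⟩
  have h2 : 2 ^ m.primeFactors.card ≤ m := by
    calc 2 ^ m.primeFactors.card ≤ ∏ p ∈ m.primeFactors, p :=
          Finset.pow_card_le_prod _ _ _ fun p hp => (Nat.prime_of_mem_primeFactors hp).two_le
      _ ≤ m := Nat.le_of_dvd (by omega) (Nat.prod_primeFactors_dvd m)
  have h3 : m.primeFactors.card < L :=
    (Nat.pow_lt_pow_iff_right (by norm_num : 1 < 2)).1 (lt_of_le_of_lt h2 hmL)
  have h4 := (Finset.card_le_card h1).trans (Finset.card_insert_le _ _)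
  have : (Q.filter (fun c => c ∣ m)).card ≤ L + 1 := by omega
  exact_mod_cast this

lemma sum_Q_le (Q : Finset ℕ) (z : ℕ) (hQ : ∀ c ∈ Q, c = 1 ∨ (c.Prime ∧ z ≤ c)) (L m : ℕ)
    (hm : 1 ≤ m) (hmL : m < 2 ^ L) (f : ℕ → ℝ) (hf : ∀ c, |f c| ≤ 1) :
    |∑ c ∈ Q, if c ∣ m then f c else 0| ≤ L + 1 := by
  rw [← Finset.sum_filter]
  refine (Finset.abs_sum_le_sum_abs _ _).trans ?_
  refine (Finset.sum_le_sum fun c _ => hf c).trans ?_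
  rw [Finset.sum_const, nsmul_eq_mul, mul_one]
  exact card_Q_dvd Q z hQ L m hm hmL

def good (z d : ℕ) : Prop := Squarefree d ∧ ∀ p, p.Prime → p ∣ d → p < z

open Classical in
lemma split_c {ι : Type} [Fintype ι] (k L z : ℕ) (b : ι → ZMod (2 ^ k)) (c : ℕ)
    (hc1 : 1 ≤ c) (hcY : c < 2 ^ k) :
    ∑ N ∈ (Finset.range (2 ^ L)).filter (fun N => 1 ≤ N ∧ c * N < 2 ^ L),
      (if sift z N then Dl (2 ^ k) b (c * N) else 0) =
    (∑ m ∈ Finset.range (2 ^ L), ∑ e ∈ Finset.range (2 ^ L),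
      if 1 ≤ m ∧ 1 ≤ e ∧ m * e < 2 ^ L ∧ c ∣ m then
        (if good z (m / c) ∧ m < 2 ^ k then mu (m / c) * Dl (2 ^ k) b (m * e) else 0) else 0) +
    (∑ m ∈ Finset.range (2 ^ L), ∑ e ∈ Finset.range (2 ^ L),
      if 1 ≤ m ∧ 1 ≤ e ∧ m * e < 2 ^ L ∧ c ∣ m then
        (if good z (m / c) ∧ 2 ^ k ≤ m ∧ c * (m / c / (m / c).minFac) < 2 ^ k ∧
          sift (m / c).minFac e then mu (m / c) * Dl (2 ^ k) b (m * e) else 0) else 0) := by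
  rw [← reindex c (2 ^ L) hc1 (fun m e => 
        (if good z (m / c) ∧ m < 2 ^ k then mu (m / c) * Dl (2 ^ k) b (m * e) else 0)),
    ← reindex c (2 ^ L) hc1 (fun m e =>
        (if good z (m / c) ∧ 2 ^ k ≤ m ∧ c * (m / c / (m / c).minFac) < 2 ^ k ∧
          sift (m / c).minFac e then mu (m / c) * Dl (2 ^ k) b (m * e) else 0)),
    ← Finset.sum_add_distrib]
  refine Finset.sum_congr rfl fun N hN => ?_
  rw [Finset.mem_filter] at hN
  have h := sieve_id z N (2 ^ k) c hN.2.1 hc1 hcY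
  have e0 : (if sift z N then Dl (2 ^ k) b (c * N) else 0) =
      (if sift z N then (1 : ℝ) else 0) * Dl (2 ^ k) b (c * N) := by split_ifs <;> simp
  rw [e0, h, add_mul, Finset.sum_mul, Finset.sum_mul]
  unfold Sm
  rw [Finset.sum_filter, Finset.sum_filter]
  have hm : ∀ d ∈ N.divisors, c * d * (N / d) = c * N := by
    intro d hd
    rw [mul_assoc, Nat.mul_div_cancel' (Nat.dvd_of_mem_divisors hd)]
  congr 1
  · refine Finset.sum_congr rfl fun d hd => ?_
    rw [Nat.mul_div_cancel_left _ hc1, hm d hd]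
    unfold good
    by_cases g1 : Squarefree d ∧ ∀ p, p.Prime → p ∣ d → p < z
    · rw [if_pos g1]
      by_cases g2 : c * d < 2 ^ k
      · rw [if_pos g2, if_pos ⟨g1, g2⟩]
      · rw [if_neg g2, if_neg (fun h => g2 h.2), zero_mul]
    · rw [if_neg g1, if_neg (fun h => g1 h.1)]
  · refine Finset.sum_congr rfl fun d hd => ?_
    rw [Nat.mul_div_cancel_left _ hc1, hm d hd]
    unfold good
    by_cases g1 : Squarefree d ∧ ∀ p, p.Prime → p ∣ d → p < z
    · rw [if_pos g1]
      by_cases g2 : 2 ^ k ≤ c * d ∧ c * (d / d.minFac) < 2 ^ k ∧ sift d.minFac (N / d)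
      · rw [if_pos g2, if_pos ⟨g1, g2⟩]
      · rw [if_neg g2, if_neg (fun h => g2 h.2), zero_mul]
    · rw [if_neg g1, if_neg (fun h => g1 h.1)]

lemma sift_iff (P e x : ℕ) (he : 1 ≤ e) (hP : P ≤ x) :
    sift P e ↔ P ≤ (if e = 1 then x else e.minFac) := by
  unfold sift
  split_ifs with h
  · refine ⟨fun _ => hP, fun _ p hp _ hpe => ?_⟩
    rw [h] at hpe
    exact hp.one_lt.ne' (Nat.dvd_one.1 hpe)
  · constructor
    · intro hs
      by_contra hlt
      exact hs _ (Nat.minFac_prime h) (by omega) (Nat.minFac_dvd e)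
    · intro hle p hp hpP hpe
      have := Nat.minFac_le_of_dvd hp.two_le hpe
      omega

lemma Dl_zero {ι : Type} [Fintype ι] (k : ℕ) (hk : 1 ≤ k) (b : ι → ZMod (2 ^ k))
    (hb : ∀ i, IsUnit (b i)) : Dl (2 ^ k) b 0 = 0 := by
  have hn : Fact (1 < 2 ^ k) := ⟨Nat.one_lt_two_pow (by omega)⟩
  refine Dl_nonunit _ b hb 0 ?_
  push_cast; exact not_isUnit_zero

lemma inner_type_one {ι : Type} [Fintype ι] (k L : ℕ) (hk : 1 ≤ k) (b : ι → ZMod (2 ^ k))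
    (hb : ∀ i, IsUnit (b i)) (m : ℕ) (hm : 1 ≤ m) :
    |∑ e ∈ Finset.range (2 ^ L), if 1 ≤ e ∧ m * e < 2 ^ L then Dl (2 ^ k) b (m * e) else 0| ≤
      Fintype.card ι := by
  have hx : 0 < 2 ^ L := by positivity
  have : ∑ e ∈ Finset.range (2 ^ L), (if 1 ≤ e ∧ m * e < 2 ^ L then Dl (2 ^ k) b (m * e) else 0) =
      ∑ e ∈ Finset.range ((2 ^ L - 1) / m + 1), Dl (2 ^ k) b (m * e) := by
    have s : Finset.range ((2 ^ L - 1) / m + 1) ⊆ Finset.range (2 ^ L) := by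
      apply Finset.range_subset_range.2
      have : (2 ^ L - 1) / m ≤ 2 ^ L - 1 := Nat.div_le_self _ _
      omega
    have hiff : ∀ e, m * e < 2 ^ L ↔ e < (2 ^ L - 1) / m + 1 := by
      intro e
      rw [Nat.lt_succ_iff, Nat.le_div_iff_mul_le (by omega), mul_comm]; omega
    rw [← Finset.sum_subset s (by
      intro e _ he
      rw [if_neg]
      rintro ⟨_, h⟩
      exact he (Finset.mem_range.2 ((hiff e).1 h)))]
    refine Finset.sum_congr rfl fun e he => ?_
    by_cases he0 : e = 0
    · rw [he0, mul_zero, Dl_zero k hk b hb]; simp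
    · rw [if_pos ⟨by omega, (hiff e).2 (Finset.mem_range.1 he)⟩]
  rw [this]
  exact type_one _ b hb m _

open Classical in
lemma gen_bound {ι : Type} [Fintype ι] (k L z : ℕ) (b : ι → ZMod (2 ^ k))
    (hb : ∀ i, IsUnit (b i)) (σ : ℝ) (hσ0 : 0 ≤ σ)
    (hσ : ∀ χ : DirichletCharacter ℂ (2 ^ k), χ ≠ 1 → ‖∑ i, χ (b i)‖ ≤ σ)
    (hk : 1 ≤ k) (hkL : 2 * k ≤ L) (hz : 2 ^ k * z ≤ 2 ^ (L - k))
    (Q : Finset ℕ) (hQ1 : ∀ c ∈ Q, 1 ≤ c ∧ c < 2 ^ k)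
    (hQ : ∀ c ∈ Q, c = 1 ∨ (c.Prime ∧ z ≤ c)) :
    |∑ c ∈ Q, ∑ N ∈ (Finset.range (2 ^ L)).filter (fun N => 1 ≤ N ∧ c * N < 2 ^ L),
      (if sift z N then Dl (2 ^ k) b (c * N) else 0)| ≤
    Fintype.card ι * (L + 1) * 2 ^ k + (L + 1) ^ 4 * (4 * σ * 2 ^ L / 2 ^ k) := by
  rw [Finset.sum_congr rfl fun c hc => split_c k L z b c (hQ1 c hc).1 (hQ1 c hc).2,
    Finset.sum_add_distrib]
  have hkL' : 2 ^ k ≤ 2 ^ L := Nat.pow_le_pow_right (by norm_num) (by omega)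
  have hkL'' : 2 ^ (L - k) ≤ 2 ^ L := Nat.pow_le_pow_right (by norm_num) (by omega)
  refine (abs_add_le _ _).trans (add_le_add ?_ ?_)
  · set α : ℕ → ℝ := fun m => if 1 ≤ m ∧ m < 2 ^ k then
      ∑ c ∈ Q, (if c ∣ m then (if good z (m / c) then mu (m / c) else 0) else 0) else 0 with hα
    have e1 : (∑ c ∈ Q, ∑ m ∈ Finset.range (2 ^ L), ∑ e ∈ Finset.range (2 ^ L),
      if 1 ≤ m ∧ 1 ≤ e ∧ m * e < 2 ^ L ∧ c ∣ m then
        (if good z (m / c) ∧ m < 2 ^ k then mu (m / c) * Dl (2 ^ k) b (m * e) else 0) else 0) =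
        ∑ m ∈ Finset.range (2 ^ k), α m * ∑ e ∈ Finset.range (2 ^ L),
          if 1 ≤ e ∧ m * e < 2 ^ L then Dl (2 ^ k) b (m * e) else 0 := by
      rw [Finset.sum_comm]
      symm
      rw [Finset.sum_subset (Finset.range_subset_range.2 hkL') (by
        intro m _ hm
        rw [hα]
        simp only
        rw [if_neg (fun h => hm (Finset.mem_range.2 h.2)), zero_mul])]
      refine Finset.sum_congr rfl fun m _ => ?_
      rw [Finset.mul_sum, Finset.sum_comm]
      refine Finset.sum_congr rfl fun e _ => ?_
      simp only [hα]
      by_cases g1 : 1 ≤ m ∧ m < 2 ^ k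
      · rw [if_pos g1, Finset.sum_mul]
        refine Finset.sum_congr rfl fun c _ => ?_
        by_cases g2 : c ∣ m <;> by_cases g3 : 1 ≤ e ∧ m * e < 2 ^ L <;>
          by_cases g4 : good z (m / c) <;> simp [g1, g2, g3, g4]
      · rw [if_neg g1, zero_mul]
        symm
        refine Finset.sum_eq_zero fun c _ => ?_
        by_cases g2 : 1 ≤ m
        · have g3 : ¬ m < 2 ^ k := fun h => g1 ⟨g2, h⟩
          simp [g3]
        · simp [g2]
    rw [e1]
    refine (Finset.abs_sum_le_sum_abs _ _).trans ?_
    have : ∀ m ∈ Finset.range (2 ^ k), |α m * ∑ e ∈ Finset.range (2 ^ L),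
          if 1 ≤ e ∧ m * e < 2 ^ L then Dl (2 ^ k) b (m * e) else 0| ≤
          (L + 1) * Fintype.card ι := by
      intro m hm
      rw [Finset.mem_range] at hm
      by_cases g1 : 1 ≤ m
      · rw [abs_mul]
        gcongr
        · simp only [hα]
          rw [if_pos ⟨g1, hm⟩]
          refine sum_Q_le Q z hQ L m g1 (by omega) _ fun c => ?_
          split_ifs
          · exact abs_mu_le _
          · simp
        · exact inner_type_one k L hk b hb m g1
      · simp only [hα]
        rw [if_neg (fun h => g1 h.1), zero_mul, abs_zero]; positivity
    refine (Finset.sum_le_sum this).trans (le_of_eq ?_)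
    rw [Finset.sum_const, nsmul_eq_mul, Finset.card_range]
    push_cast; ring
  · set α : ℕ → ℝ := fun m => if 2 ^ k ≤ m ∧ m < 2 ^ (L - k) then
      ∑ c ∈ Q, (if c ∣ m then (if good z (m / c) ∧ c * (m / c / (m / c).minFac) < 2 ^ k
        then mu (m / c) else 0) else 0) else 0 with hα
    have e1 : (∑ c ∈ Q, ∑ m ∈ Finset.range (2 ^ L), ∑ e ∈ Finset.range (2 ^ L),
      if 1 ≤ m ∧ 1 ≤ e ∧ m * e < 2 ^ L ∧ c ∣ m then
        (if good z (m / c) ∧ 2 ^ k ≤ m ∧ c * (m / c / (m / c).minFac) < 2 ^ k ∧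
          sift (m / c).minFac e then mu (m / c) * Dl (2 ^ k) b (m * e) else 0) else 0) =
        ∑ m ∈ Finset.range (2 ^ L), ∑ e ∈ Finset.range (2 ^ L), α m *
          (if e = 0 then 0 else 1) * (if m * e < 2 ^ L ∧
            m.minFac ≤ (if e = 1 then 2 ^ L else e.minFac) then Dl (2 ^ k) b (m * e) else 0) := by
      rw [Finset.sum_comm]
      refine Finset.sum_congr rfl fun m hmx => ?_
      rw [Finset.mem_range] at hmx
      rw [Finset.sum_comm]
      refine Finset.sum_congr rfl fun e _ => ?_
      by_cases he : e = 0
      · simp [he]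
      have he1 : 1 ≤ e := by omega
      by_cases hm0 : m = 0
      · have : α m = 0 := by
          simp only [hα]; rw [if_neg]; rw [hm0]; rintro ⟨h, _⟩
          have : 0 < 2 ^ k := by positivity
          omega
        rw [this]; simp [hm0]
      have hm1 : 1 ≤ m := by omega
      have hmf : m.minFac ≤ 2 ^ L := (Nat.minFac_le hm1).trans hmx.le
      rw [if_neg he, mul_one]
      have hsi := sift_iff m.minFac e (2 ^ L) he1 hmf
      simp only [← hsi]
      -- claim about each c
      have key : ∀ c ∈ Q, c ∣ m → (good z (m / c) ∧ 2 ^ k ≤ m ∧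
          c * (m / c / (m / c).minFac) < 2 ^ k) →
          m < 2 ^ (L - k) ∧ (m / c).minFac = m.minFac := by
        rintro c hc ⟨d, rfl⟩ ⟨g1, g2, g3⟩
        have hc1 := hQ1 c hc
        rw [Nat.mul_div_cancel_left _ hc1.1] at g1 g3 ⊢
        have hd1 : d ≠ 1 := by rintro rfl; omega
        have hp := Nat.minFac_prime hd1
        have hpz := g1.2 _ hp (Nat.minFac_dvd d)
        constructor
        · have : c * d = c * (d / d.minFac) * d.minFac := by
            rw [mul_assoc, Nat.div_mul_cancel (Nat.minFac_dvd d)]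
          rw [this]
          calc _ < 2 ^ k * z := Nat.mul_lt_mul'' g3 hpz
            _ ≤ _ := hz
        · apply le_antisymm
          · have hcd : c * d ≠ 1 := fun h => hd1 (Nat.eq_one_of_mul_eq_one_left h)
            have hp2 := Nat.minFac_prime hcd
            rcases hp2.dvd_mul.1 (Nat.minFac_dvd (c * d)) with h | h
            · rcases hQ c hc with h1 | ⟨h1, h2⟩
              · rw [h1, one_mul]
              · rw [(Nat.prime_dvd_prime_iff_eq hp2 h1).1 h]; omega
            · exact Nat.minFac_le_of_dvd hp2.two_le h
          · exact Nat.minFac_le_of_dvd hp.two_le ((Nat.minFac_dvd d).trans (dvd_mul_left _ _))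
      by_cases g0 : m * e < 2 ^ L ∧ sift m.minFac e
      · rw [if_pos g0]
        simp only [hα]
        by_cases g1 : 2 ^ k ≤ m ∧ m < 2 ^ (L - k)
        · rw [if_pos g1, Finset.sum_mul]
          refine Finset.sum_congr rfl fun c hc => ?_
          by_cases g2 : c ∣ m
          · rw [if_pos ⟨hm1, he1, g0.1, g2⟩, if_pos g2]
            by_cases g3 : good z (m / c) ∧ c * (m / c / (m / c).minFac) < 2 ^ k
            · have kk := (key c hc g2 ⟨g3.1, g1.1, g3.2⟩).2
              rw [if_pos g3, if_pos ⟨g3.1, g1.1, g3.2, by rw [kk]; exact g0.2⟩]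
            · rw [if_neg g3, zero_mul, if_neg (fun h => g3 ⟨h.1, h.2.2.1⟩)]
          · rw [if_neg g2, zero_mul, if_neg (fun h => g2 h.2.2.2)]
        · rw [if_neg g1, zero_mul]
          refine Finset.sum_eq_zero fun c hc => ?_
          by_cases g2 : c ∣ m
          · rw [if_pos ⟨hm1, he1, g0.1, g2⟩, if_neg]
            rintro ⟨h1, h2, h3, _⟩
            exact g1 ⟨h2, (key c hc g2 ⟨h1, h2, h3⟩).1⟩
          · rw [if_neg (fun h => g2 h.2.2.2)]
      · rw [if_neg g0, mul_zero]
        refine Finset.sum_eq_zero fun c hc => ?_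
        by_cases g2 : 1 ≤ m ∧ 1 ≤ e ∧ m * e < 2 ^ L ∧ c ∣ m
        · rw [if_pos g2, if_neg]
          rintro ⟨h1, h2, h3, h4⟩
          rw [(key c hc g2.2.2.2 ⟨h1, h2, h3⟩).2] at h4
          exact g0 ⟨g2.2.2.1, h4⟩
        · rw [if_neg g2]
    rw [e1]
    have hLp : 2 ^ (L + 1) = 2 ^ L * 2 := pow_succ _ _
    have hL2 : 2 ≤ 2 ^ L := by
      calc 2 = 2 ^ 1 := by norm_num
        _ ≤ 2 ^ L := Nat.pow_le_pow_right (by norm_num) (by omega)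
    have := type_two k L b hb σ hσ0 hσ α (fun e => if e = 0 then 0 else 1) (L + 1) (by positivity)
      (by
        intro m
        simp only [hα]
        split_ifs with h
        · refine sum_Q_le Q z hQ L m ?_ (by omega) _ fun c => ?_
          · have : 0 < 2 ^ k := by positivity
            omega
          · split_ifs
            · exact abs_mu_le _
            · simp
        · rw [abs_zero]; positivity)
      (by intro e; split_ifs <;> simp) (by simp)
      Nat.minFac (fun e => if e = 1 then 2 ^ L else e.minFac)
      (by
        intro m hm
        rcases Nat.eq_zero_or_pos m with h | h
        · rw [h, Nat.minFac_zero]; omega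
        · have := Nat.minFac_le h; omega)
      (by
        intro e he
        split_ifs with h1
        · omega
        · rcases Nat.eq_zero_or_pos e with h | h
          · rw [h, Nat.minFac_zero]; omega
          · have := Nat.minFac_le h; omega) hk hkL
      (by
        intro m hm
        by_contra h
        exact hm (by simp only [hα]; rw [if_neg h]))
    refine this.trans (le_of_eq ?_)
    ring


open Classical in
lemma decomp (x z Y : ℕ) (hx : 1 < x) (hzY : z ≤ Y) (f : ℕ → ℝ) :
    ∑ N ∈ (Finset.range x).filter (fun N => 1 ≤ N ∧ 1 * N < x), (if sift z N then f (1 * N) else 0) =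
    f 1 + ∑ N ∈ (Finset.range x).filter (fun N => N.Prime ∧ z ≤ N), f N +
    ∑ N ∈ (Finset.range x).filter (fun N => 2 ≤ N ∧ ¬ N.Prime ∧ Y ≤ N.minFac), f N +
    ∑ N ∈ (Finset.range x).filter (fun N => 2 ≤ N ∧ ¬ N.Prime ∧ z ≤ N.minFac ∧ N.minFac < Y),
      f N := by
  have e1 : f 1 = ∑ N ∈ Finset.range x, if N = 1 then f N else 0 := by
    rw [Finset.sum_ite_eq', if_pos (Finset.mem_range.2 hx)]
  rw [e1]
  simp only [Finset.sum_filter]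
  simp only [← Finset.sum_add_distrib]
  refine Finset.sum_congr rfl fun N hN => ?_
  rw [Finset.mem_range] at hN
  rw [one_mul]
  rcases Nat.lt_trichotomy N 1 with h | h | h
  · have : N = 0 := by omega
    subst this
    simp [Nat.not_prime_zero]
  · subst h
    have : sift z 1 := fun p hp _ h => hp.one_lt.ne' (Nat.dvd_one.1 h)
    simp [this, hx, Nat.not_prime_one]
  · have hs : sift z N ↔ z ≤ N.minFac := by
      constructor
      · intro hs
        by_contra hlt
        exact hs _ (Nat.minFac_prime (by omega)) (by omega) (Nat.minFac_dvd N)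
      · intro hle p hp hpP hpe
        have := Nat.minFac_le_of_dvd hp.two_le hpe
        omega
    have h1 : 1 ≤ N ∧ N < x := ⟨by omega, hN⟩
    have h2 : N ≠ 1 := by omega
    have h3 : 2 ≤ N := h
    rw [if_pos h1, if_neg h2]
    simp only [hs, h3, true_and]
    by_cases hp : N.Prime
    · simp [hp, hp.minFac_eq]
    · by_cases h4 : z ≤ N.minFac <;> by_cases h5 : Y ≤ N.minFac <;> simp [hp, h4, h5]
      omega

open Classical in
lemma C_le_T (x z Y : ℕ) (f : ℕ → ℝ) (hf : ∀ n, 0 ≤ f n) :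
    ∑ N ∈ (Finset.range x).filter (fun N => 2 ≤ N ∧ ¬ N.Prime ∧ z ≤ N.minFac ∧ N.minFac < Y),
      f N ≤
    ∑ c ∈ (Finset.range Y).filter (fun c => c.Prime ∧ z ≤ c),
      ∑ N ∈ (Finset.range x).filter (fun N => 1 ≤ N ∧ c * N < x),
        (if sift z N then f (c * N) else 0) := by
  rw [Finset.sum_sigma' ((Finset.range Y).filter (fun c => c.Prime ∧ z ≤ c))
    (fun c => (Finset.range x).filter (fun N => 1 ≤ N ∧ c * N < x))
    (fun c N => if sift z N then f (c * N) else 0)]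
  set i : ℕ → (_ : ℕ) × ℕ := fun N => ⟨N.minFac, N / N.minFac⟩ with hi
  have hinj : Set.InjOn i ((Finset.range x).filter
      (fun N => 2 ≤ N ∧ ¬ N.Prime ∧ z ≤ N.minFac ∧ N.minFac < Y)) := by
    intro a _ b _ hab
    simp only [hi, Sigma.mk.injEq, heq_eq_eq] at hab
    rw [← Nat.mul_div_cancel' (Nat.minFac_dvd a), ← Nat.mul_div_cancel' (Nat.minFac_dvd b),
      hab.2, hab.1]
  have key : ∀ N ∈ (Finset.range x).filter
      (fun N => 2 ≤ N ∧ ¬ N.Prime ∧ z ≤ N.minFac ∧ N.minFac < Y),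
      f N = (fun p : (_ : ℕ) × ℕ => if sift z p.2 then f (p.1 * p.2) else 0) (i N) := by
    intro N hN
    rw [Finset.mem_filter] at hN
    simp only [hi]
    rw [if_pos, Nat.mul_div_cancel' (Nat.minFac_dvd N)]
    intro p hp hpz hpd
    have := Nat.minFac_le_of_dvd hp.two_le (hpd.trans (Nat.div_dvd_of_dvd (Nat.minFac_dvd N)))
    omega
  rw [Finset.sum_congr rfl key, ← Finset.sum_image
    (f := fun p : (_ : ℕ) × ℕ => if sift z p.2 then f (p.1 * p.2) else 0) hinj]
  apply Finset.sum_le_sum_of_subset_of_nonneg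
  · intro p hp
    rw [Finset.mem_image] at hp
    obtain ⟨N, hN, rfl⟩ := hp
    rw [Finset.mem_filter, Finset.mem_range] at hN
    simp only [hi, Finset.mem_sigma, Finset.mem_filter, Finset.mem_range]
    have hpr := Nat.minFac_prime (by omega : N ≠ 1)
    have hle : N / N.minFac ≤ N := Nat.div_le_self _ _
    have hpos : 0 < N / N.minFac := Nat.div_pos (Nat.minFac_le (by omega)) hpr.pos
    rw [Nat.mul_div_cancel' (Nat.minFac_dvd N)]
    exact ⟨⟨hN.2.2.2.2, hpr, hN.2.2.2.1⟩, by omega, hpos, hN.1⟩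
  · intro p _ _
    split_ifs
    · exact hf _
    · exact le_rfl

lemma G_eq (k L : ℕ) (hkL : 2 * k ≤ L) (f : ℕ → ℝ) :
    ∑ N ∈ (Finset.range (2 ^ L)).filter (fun N => 2 ≤ N ∧ ¬ N.Prime ∧ 2 ^ k ≤ N.minFac), f N =
    ∑ m ∈ Finset.range (2 ^ L), ∑ e ∈ Finset.range (2 ^ L),
      (if m.Prime ∧ 2 ^ k ≤ m ∧ m < 2 ^ (L - k) then 1 else 0) * (if 2 ≤ e then 1 else 0) *
        (if m * e < 2 ^ L ∧ m ≤ e.minFac then f (m * e) else 0) := by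
  have e1 : ∀ m e, (if m.Prime ∧ 2 ^ k ≤ m ∧ m < 2 ^ (L - k) then (1 : ℝ) else 0) *
      (if 2 ≤ e then 1 else 0) *
        (if m * e < 2 ^ L ∧ m ≤ e.minFac then f (m * e) else 0) =
      if (m.Prime ∧ 2 ^ k ≤ m ∧ m < 2 ^ (L - k)) ∧ 2 ≤ e ∧ m * e < 2 ^ L ∧ m ≤ e.minFac
        then f (m * e) else 0 := by
    intro m e
    by_cases h1 : m.Prime ∧ 2 ^ k ≤ m ∧ m < 2 ^ (L - k) <;> by_cases h2 : 2 ≤ e <;>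
      simp [h1, h2]
  simp only [e1]
  rw [← Finset.sum_product', ← Finset.sum_filter]
  refine Finset.sum_bij' (fun N _ => (N.minFac, N / N.minFac)) (fun p _ => p.1 * p.2) ?_ ?_ ?_ ?_ ?_
  · intro N hN
    simp only [Finset.mem_filter, Finset.mem_range, Finset.mem_product] at hN ⊢
    obtain ⟨h1, h2, h3, h4⟩ := hN
    have hpr := Nat.minFac_prime (by omega : N ≠ 1)
    have hle : N / N.minFac ≤ N := Nat.div_le_self _ _
    have hmul := Nat.mul_div_cancel' (Nat.minFac_dvd N)
    have hmle := Nat.minFac_le (by omega : 0 < N)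
    have hsq := Nat.minFac_sq_le_self (by omega : 0 < N) h3
    have hlt : N.minFac < 2 ^ (L - k) := by
      have : N.minFac ^ 2 < (2 ^ (L - k)) ^ 2 := by
        calc _ ≤ N := hsq
          _ < 2 ^ L := h1
          _ ≤ _ := by rw [← pow_mul]; exact Nat.pow_le_pow_right (by norm_num) (by omega)
      exact lt_of_pow_lt_pow_left₀ 2 (Nat.zero_le _) this
    have h2e : 2 ≤ N / N.minFac := by
      rw [Nat.le_div_iff_mul_le hpr.pos]
      calc 2 * N.minFac ≤ N.minFac * N.minFac := Nat.mul_le_mul_right _ hpr.two_le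
        _ = N.minFac ^ 2 := (sq _).symm
        _ ≤ N := hsq
    refine ⟨⟨by omega, by omega⟩, ⟨hpr, h4, hlt⟩, h2e, by rw [hmul]; exact h1, ?_⟩
    exact Nat.minFac_le_of_dvd (Nat.minFac_prime (by omega)).two_le
      ((Nat.minFac_dvd _).trans (Nat.div_dvd_of_dvd (Nat.minFac_dvd N)))
  · rintro ⟨m, e⟩ hp
    simp only [Finset.mem_filter, Finset.mem_range, Finset.mem_product] at hp ⊢
    obtain ⟨⟨h1, h2⟩, ⟨h3, h4, h5⟩, h6, h7, h8⟩ := hp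
    have hme : 2 ≤ m * e := by nlinarith [h3.two_le]
    refine ⟨h7, hme, Nat.not_prime_mul h3.one_lt.ne' (by omega), ?_⟩
    have hpr := Nat.minFac_prime (by omega : m * e ≠ 1)
    rcases hpr.dvd_mul.1 (Nat.minFac_dvd (m * e)) with h | h
    · rw [(Nat.prime_dvd_prime_iff_eq hpr h3).1 h]; exact h4
    · have := Nat.minFac_le_of_dvd hpr.two_le h; omega
  · intro N _
    simp only [Nat.mul_div_cancel' (Nat.minFac_dvd N)]
  · rintro ⟨m, e⟩ hp
    simp only [Finset.mem_filter, Finset.mem_range, Finset.mem_product] at hp ⊢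
    obtain ⟨⟨h1, h2⟩, ⟨h3, h4, h5⟩, h6, h7, h8⟩ := hp
    have hme : 2 ≤ m * e := by nlinarith [h3.two_le]
    have hpr := Nat.minFac_prime (by omega : m * e ≠ 1)
    have : (m * e).minFac = m := by
      apply le_antisymm (Nat.minFac_le_of_dvd h3.two_le (dvd_mul_right _ _))
      rcases hpr.dvd_mul.1 (Nat.minFac_dvd (m * e)) with h | h
      · rw [(Nat.prime_dvd_prime_iff_eq hpr h3).1 h]
      · have := Nat.minFac_le_of_dvd hpr.two_le h; omega
    rw [this, Nat.mul_div_cancel_left _ h3.pos]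
  · intro N _
    simp only [Nat.mul_div_cancel' (Nat.minFac_dvd N)]

lemma G_bound {ι : Type} [Fintype ι] (k L : ℕ) (b : ι → ZMod (2 ^ k))
    (hb : ∀ i, IsUnit (b i)) (σ : ℝ) (hσ0 : 0 ≤ σ)
    (hσ : ∀ χ : DirichletCharacter ℂ (2 ^ k), χ ≠ 1 → ‖∑ i, χ (b i)‖ ≤ σ)
    (hk : 1 ≤ k) (hkL : 2 * k ≤ L) :
    |∑ N ∈ (Finset.range (2 ^ L)).filter (fun N => 2 ≤ N ∧ ¬ N.Prime ∧ 2 ^ k ≤ N.minFac),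
      Dl (2 ^ k) b N| ≤ (L + 1) ^ 4 * (4 * σ * 2 ^ L / 2 ^ k) := by
  rw [G_eq k L hkL]
  have hLp : 2 ^ (L + 1) = 2 ^ L * 2 := pow_succ _ _
  have hL2 : 2 ≤ 2 ^ L := by
    calc 2 = 2 ^ 1 := by norm_num
      _ ≤ 2 ^ L := Nat.pow_le_pow_right (by norm_num) (by omega)
  have := type_two k L b hb σ hσ0 hσ
    (fun m => if m.Prime ∧ 2 ^ k ≤ m ∧ m < 2 ^ (L - k) then 1 else 0)
    (fun e => if 2 ≤ e then 1 else 0) 1 (by norm_num)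
    (by intro m; split_ifs <;> simp) (by intro m; split_ifs <;> simp) (by simp)
    (fun m => m) Nat.minFac (by intro m hm; omega)
    (by
      intro e he
      rcases Nat.eq_zero_or_pos e with h | h
      · rw [h, Nat.minFac_zero]; omega
      · have := Nat.minFac_le h; omega) hk hkL
    (by intro m hm; by_contra h; exact hm (if_neg fun hh => h hh.2))
  refine this.trans ?_
  rw [mul_one]
  have h1 : (1 : ℝ) ≤ (L : ℝ) + 1 := by linarith [(Nat.cast_nonneg L : (0 : ℝ) ≤ L)]
  gcongr
  norm_num

open Classical in
lemma prime_lower {ι : Type} [Fintype ι] (k L z : ℕ) (b : ι → ZMod (2 ^ k))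
    (hb : ∀ i, IsUnit (b i)) (σ : ℝ) (hσ0 : 0 ≤ σ)
    (hσ : ∀ χ : DirichletCharacter ℂ (2 ^ k), χ ≠ 1 → ‖∑ i, χ (b i)‖ ≤ σ)
    (hk : 1 ≤ k) (hkL : 2 * k ≤ L) (hz : 2 ^ k * z ≤ 2 ^ (L - k)) (hz3 : 3 ≤ z)
    (hzY : z ≤ 2 ^ k) :
    (Fintype.card ι / (2 ^ k : ℕ).totient : ℝ) *
      (((Finset.range (2 ^ L)).filter (fun N => N.Prime ∧ z ≤ N)).card -
        ∑ c ∈ (Finset.range (2 ^ k)).filter (fun c => c.Prime ∧ z ≤ c),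
          ∑ N ∈ (Finset.range (2 ^ L)).filter (fun N => 1 ≤ N ∧ c * N < 2 ^ L),
            (if sift z N then (1 : ℝ) else 0)) - Fintype.card ι -
      3 * (Fintype.card ι * (L + 1) * 2 ^ k + (L + 1) ^ 4 * (4 * σ * 2 ^ L / 2 ^ k)) ≤
    ∑ N ∈ (Finset.range (2 ^ L)).filter (fun N => N.Prime ∧ z ≤ N), Wt (2 ^ k) b N := by
  set lam : ℝ := (Fintype.card ι / (2 ^ k : ℕ).totient : ℝ) with hlam
  have hlam0 : 0 ≤ lam := by positivity
  set U : ℕ → ℝ := fun n => if IsUnit (n : ZMod (2 ^ k)) then 1 else 0 with hU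
  have hU0 : ∀ n, 0 ≤ U n := by intro n; simp only [hU]; split_ifs <;> simp
  have hU1 : ∀ n, U n ≤ 1 := by intro n; simp only [hU]; split_ifs <;> simp
  have hx : 1 < 2 ^ L := Nat.one_lt_two_pow (by omega)
  have hW : ∀ n, Wt (2 ^ k) b n = Dl (2 ^ k) b n + lam * U n := by
    intro n
    by_cases h : IsUnit (n : ZMod (2 ^ k)) <;> simp [Dl, hU, h, hlam]
  have hD := decomp (2 ^ L) z (2 ^ k) hx hzY (Wt (2 ^ k) b)
  have hDU := decomp (2 ^ L) z (2 ^ k) hx hzY U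
  have hCT := C_le_T (2 ^ L) z (2 ^ k) (Wt (2 ^ k) b) (Wt_nonneg _ _)
  have hS := gen_bound k L z b hb σ hσ0 hσ hk hkL hz {1}
    (by intro c hc; rw [Finset.mem_singleton] at hc; subst hc
        exact ⟨le_rfl, Nat.one_lt_two_pow (by omega)⟩)
    (by intro c hc; exact Or.inl (Finset.mem_singleton.1 hc))
  have hT := gen_bound k L z b hb σ hσ0 hσ hk hkL hz
    ((Finset.range (2 ^ k)).filter (fun c => c.Prime ∧ z ≤ c))
    (by intro c hc; rw [Finset.mem_filter, Finset.mem_range] at hc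
        exact ⟨hc.2.1.pos, hc.1⟩)
    (by intro c hc; rw [Finset.mem_filter] at hc; exact Or.inr hc.2)
  have hG := G_bound k L b hb σ hσ0 hσ hk hkL
  rw [Finset.sum_singleton] at hS
  -- linearity
  have linS : ∀ c, ∑ N ∈ (Finset.range (2 ^ L)).filter (fun N => 1 ≤ N ∧ c * N < 2 ^ L),
      (if sift z N then Wt (2 ^ k) b (c * N) else 0) =
      ∑ N ∈ (Finset.range (2 ^ L)).filter (fun N => 1 ≤ N ∧ c * N < 2 ^ L),
      (if sift z N then Dl (2 ^ k) b (c * N) else 0) +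
      lam * ∑ N ∈ (Finset.range (2 ^ L)).filter (fun N => 1 ≤ N ∧ c * N < 2 ^ L),
      (if sift z N then U (c * N) else 0) := by
    intro c
    rw [Finset.mul_sum, ← Finset.sum_add_distrib]
    refine Finset.sum_congr rfl fun N _ => ?_
    split_ifs
    · exact hW _
    · ring
  have linG : ∑ N ∈ (Finset.range (2 ^ L)).filter (fun N => 2 ≤ N ∧ ¬ N.Prime ∧ 2 ^ k ≤ N.minFac),
      Wt (2 ^ k) b N = 
      ∑ N ∈ (Finset.range (2 ^ L)).filter (fun N => 2 ≤ N ∧ ¬ N.Prime ∧ 2 ^ k ≤ N.minFac),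
      Dl (2 ^ k) b N + lam *
      ∑ N ∈ (Finset.range (2 ^ L)).filter (fun N => 2 ≤ N ∧ ¬ N.Prime ∧ 2 ^ k ≤ N.minFac), U N := by
    rw [Finset.mul_sum, ← Finset.sum_add_distrib]
    exact Finset.sum_congr rfl fun N _ => hW _
  have hPU : ∑ N ∈ (Finset.range (2 ^ L)).filter (fun N => N.Prime ∧ z ≤ N), U N =
      ((Finset.range (2 ^ L)).filter (fun N => N.Prime ∧ z ≤ N)).card := by
    rw [Finset.card_eq_sum_ones, Nat.cast_sum]
    refine Finset.sum_congr rfl fun N hN => ?_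
    rw [Finset.mem_filter] at hN
    simp only [hU]
    rw [if_pos]
    · simp
    · rw [ZMod.isUnit_iff_coprime]
      apply Nat.Coprime.pow_right
      rw [Nat.coprime_primes hN.2.1 Nat.prime_two]
      omega
  have hTU : ∑ c ∈ (Finset.range (2 ^ k)).filter (fun c => c.Prime ∧ z ≤ c),
      ∑ N ∈ (Finset.range (2 ^ L)).filter (fun N => 1 ≤ N ∧ c * N < 2 ^ L),
        (if sift z N then U (c * N) else 0) ≤
      ∑ c ∈ (Finset.range (2 ^ k)).filter (fun c => c.Prime ∧ z ≤ c),
      ∑ N ∈ (Finset.range (2 ^ L)).filter (fun N => 1 ≤ N ∧ c * N < 2 ^ L),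
        (if sift z N then (1 : ℝ) else 0) := by
    refine Finset.sum_le_sum fun c _ => Finset.sum_le_sum fun N _ => ?_
    split_ifs
    · exact hU1 _
    · exact le_rfl
  have hCU : 0 ≤ ∑ N ∈ (Finset.range (2 ^ L)).filter
      (fun N => 2 ≤ N ∧ ¬ N.Prime ∧ z ≤ N.minFac ∧ N.minFac < 2 ^ k), U N :=
    Finset.sum_nonneg fun N _ => hU0 N
  have hW1 := Wt_le (2 ^ k) b 1
  have hU10 := hU0 1
  rw [linS 1, linG] at hD
  rw [Finset.sum_congr rfl fun c _ => linS c, Finset.sum_add_distrib, ← Finset.mul_sum] at hCT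
  rw [hPU] at hDU
  have hTU' := mul_le_mul_of_nonneg_left hTU hlam0
  have a1 := (abs_le.1 hS).1
  have a2 := (abs_le.1 hT).2
  have a3 := (abs_le.1 hG).2
  have a4 : 0 ≤ (Fintype.card ι : ℝ) * (L + 1) * 2 ^ k := by positivity
  have hDU' := congrArg (fun t => lam * t) hDU
  simp only [mul_add] at hDU'
  have a5 := mul_nonneg hlam0 hCU
  have a6 := mul_nonneg hlam0 hU10
  rw [mul_sub]
  linarith


def Pz (ζ t : ℕ) : Finset ℕ := (Finset.range (t + 1)).filter (fun N => N.Prime ∧ 2 ^ ζ ≤ N)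

lemma Pz_card (ζ t : ℕ) : ζ * (Pz ζ t).card ≤ 2 * t := by
  have h1 : (2 ^ ζ) ^ (Pz ζ t).card ≤ ∏ p ∈ Pz ζ t, p := by
    rw [← Finset.prod_const]
    apply Finset.prod_le_prod' 
    intro p hp
    rw [Pz, Finset.mem_filter] at hp
    exact hp.2.2
  have h2 : ∏ p ∈ Pz ζ t, p ≤ primorial t := by
    unfold primorial
    apply Finset.prod_le_prod_of_subset_of_one_le'
    · intro p hp
      rw [Pz, Finset.mem_filter] at hp
      rw [Finset.mem_filter]
      exact ⟨hp.1, hp.2.1⟩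
    · intro p hp _
      rw [Finset.mem_filter] at hp
      exact hp.2.pos
  have h3 := primorial_le_four_pow t
  have h4 : 2 ^ (ζ * (Pz ζ t).card) ≤ 2 ^ (2 * t) := by
    rw [pow_mul, pow_mul]
    exact h1.trans (h2.trans h3)
  exact (Nat.pow_le_pow_iff_right (by norm_num)).1 h4

lemma Pz_card_real (ζ x m : ℕ) (hζ : 1 ≤ ζ) :
    ((Pz ζ (x / m)).card : ℝ) ≤ 2 * x / ζ * (1 / m) := by
  have h1 : ((ζ * (Pz ζ (x / m)).card : ℕ) : ℝ) ≤ ((2 * (x / m) : ℕ) : ℝ) :=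
    Nat.cast_le.2 (Pz_card ζ (x / m))
  push_cast at h1
  have h2 : ((x / m : ℕ) : ℝ) ≤ x / m := Nat.cast_div_le
  have h3 : (0 : ℝ) < ζ := by exact_mod_cast hζ
  have : 2 * (x : ℝ) / ζ * (1 / m) = (2 * (x / m)) / ζ := by ring
  rw [this, le_div_iff₀ h3]
  linarith

lemma prime_count_lower (L z : ℕ) (hL : 2 ≤ L) :
    (2 : ℝ) ^ L / L - 3 - z ≤ ((Finset.range (2 ^ L)).filter (fun N => N.Prime ∧ z ≤ N)).card := by
  have h := Chebyshev.pi_ge (2 ^ L)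
  have hl2 : 0 < Real.log 2 := Real.log_pos (by norm_num)
  have hLR : (2 : ℝ) ≤ L := by exact_mod_cast hL
  have h1 : Real.log ((2 ^ L : ℕ) + 1 : ℝ) ≤ (L + 1) * Real.log 2 := by
    have : ((L : ℝ) + 1) * Real.log 2 = Real.log (2 ^ (L + 1)) := by
      rw [Real.log_pow]; push_cast; ring
    rw [this]
    apply Real.log_le_log (by positivity)
    push_cast
    rw [pow_succ]
    linarith [one_le_pow₀ (by norm_num : (1 : ℝ) ≤ 2) (n := L)]
  have h2 : Real.log ((2 ^ L : ℕ) : ℝ) = L * Real.log 2 := by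
    push_cast
    rw [Real.log_pow]
  rw [h2] at h
  have h3 : (2 : ℝ) ^ L / L - 2 ≤ Nat.primeCounting (2 ^ L) := by
    refine le_trans ?_ h
    rw [le_div_iff₀ (by positivity)]
    have : ((2 : ℝ) ^ L / L - 2) * (L * Real.log 2) = 2 ^ L * Real.log 2 - 2 * L * Real.log 2 := by
      field_simp
    rw [this]
    push_cast at h1 ⊢
    nlinarith
  have h4 : Nat.primeCounting (2 ^ L) ≤
      ((Finset.range (2 ^ L)).filter (fun N => N.Prime ∧ z ≤ N)).card + z + 1 := by
    rw [Nat.primeCounting, Nat.primeCounting', Nat.count_eq_card_filter_range]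
    have : (Finset.range (2 ^ L + 1)).filter Nat.Prime ⊆
        ((Finset.range (2 ^ L)).filter (fun N => N.Prime ∧ z ≤ N)) ∪ Finset.range z ∪ {2 ^ L} := by
      intro p hp
      simp only [Finset.mem_filter, Finset.mem_range, Finset.mem_union,
        Finset.mem_singleton] at hp ⊢
      have := hp.2
      by_cases hz : z ≤ p
      · simp only [this, hz, true_and, and_true]; omega
      · omega
    refine (Finset.card_le_card this).trans ((Finset.card_union_le _ _).trans ?_)
    have h5 := Finset.card_union_le
      ((Finset.range (2 ^ L)).filter (fun N => N.Prime ∧ z ≤ N)) (Finset.range z)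
    rw [Finset.card_range] at h5
    rw [Finset.card_singleton]
    omega
  have h5 : (Nat.primeCounting (2 ^ L) : ℝ) ≤
      ((Finset.range (2 ^ L)).filter (fun N => N.Prime ∧ z ≤ N)).card + z + 1 := by
    exact_mod_cast h4
  linarith

lemma recip_sum (ζ : ℕ) (hζ : 1 ≤ ζ) (d : ℕ) :
    ∑ p ∈ (Finset.range (2 ^ (ζ + d))).filter (fun c => c.Prime ∧ 2 ^ ζ ≤ c), (1 / p : ℝ) ≤
      4 * d / ζ := by
  have hζR : (0 : ℝ) < ζ := by exact_mod_cast hζ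
  induction d with
  | zero =>
    rw [Finset.sum_eq_zero]
    · positivity
    · intro p hp
      rw [Finset.mem_filter, Finset.mem_range, add_zero] at hp
      omega
  | succ d ih =>
    have hsub : (Finset.range (2 ^ (ζ + (d + 1)))).filter (fun c => c.Prime ∧ 2 ^ ζ ≤ c) ⊆
        (Finset.range (2 ^ (ζ + d))).filter (fun c => c.Prime ∧ 2 ^ ζ ≤ c) ∪
        Pz (ζ + d) (2 ^ (ζ + d + 1)) := by
      intro p hp
      simp only [Pz, Finset.mem_filter, Finset.mem_range, Finset.mem_union] at hp ⊢
      rw [← add_assoc] at hp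
      by_cases h : p < 2 ^ (ζ + d)
      · left; exact ⟨h, hp.2⟩
      · right; exact ⟨by omega, hp.2.1, by omega⟩
    have h1 : ∑ p ∈ Pz (ζ + d) (2 ^ (ζ + d + 1)), (1 / p : ℝ) ≤ 4 / ζ := by
      have h2 : ∑ p ∈ Pz (ζ + d) (2 ^ (ζ + d + 1)), (1 / p : ℝ) ≤
          (Pz (ζ + d) (2 ^ (ζ + d + 1))).card • (1 / 2 ^ (ζ + d) : ℝ) := by
        apply Finset.sum_le_card_nsmul
        intro p hp
        simp only [Pz, Finset.mem_filter] at hp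
        apply one_div_le_one_div_of_le (by positivity)
        exact_mod_cast hp.2.2
      refine h2.trans ?_
      have h3 := Pz_card_real (ζ + d) (2 ^ (ζ + d + 1)) 1 (by omega)
      rw [Nat.div_one] at h3
      rw [nsmul_eq_mul]
      have h4 : (0 : ℝ) < 2 ^ (ζ + d) := by positivity
      calc _ ≤ (2 * ((2 ^ (ζ + d + 1) : ℕ) : ℝ) / ((ζ + d : ℕ) : ℝ) * (1 / (1 : ℕ))) * (1 / 2 ^ (ζ + d)) := by
            gcongr
        _ = 4 / ((ζ + d : ℕ) : ℝ) := by
            push_cast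
            rw [pow_succ]
            field_simp
            norm_num
        _ ≤ 4 / ζ := by
            apply div_le_div_of_nonneg_left (by norm_num) hζR
            push_cast
            linarith [(Nat.cast_nonneg d : (0 : ℝ) ≤ d)]
    calc _ ≤ ∑ p ∈ (Finset.range (2 ^ (ζ + d))).filter (fun c => c.Prime ∧ 2 ^ ζ ≤ c) ∪
        Pz (ζ + d) (2 ^ (ζ + d + 1)), (1 / p : ℝ) :=
          Finset.sum_le_sum_of_subset_of_nonneg hsub (fun _ _ _ => by positivity)
      _ ≤ ∑ p ∈ (Finset.range (2 ^ (ζ + d))).filter (fun c => c.Prime ∧ 2 ^ ζ ≤ c), (1 / p : ℝ) +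
          ∑ p ∈ Pz (ζ + d) (2 ^ (ζ + d + 1)), (1 / p : ℝ) := by
          rw [← Finset.sum_union_inter]
          have : 0 ≤ ∑ p ∈ (Finset.range (2 ^ (ζ + d))).filter (fun c => c.Prime ∧ 2 ^ ζ ≤ c) ∩
            Pz (ζ + d) (2 ^ (ζ + d + 1)), (1 / p : ℝ) :=
            Finset.sum_nonneg fun _ _ => by positivity
          linarith
      _ ≤ 4 * d / ζ + 4 / ζ := by gcongr
      _ = _ := by push_cast; ring

open Classical in
lemma inner_count (ζ k L c : ℕ) (hζ : 1 ≤ ζ) (hL1 : L ≤ ζ + 2 * k) (hL2 : L ≤ 4 * ζ)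
    (hc : 2 ^ ζ ≤ c) :
    ∑ N ∈ (Finset.range (2 ^ L)).filter (fun N => 1 ≤ N ∧ c * N < 2 ^ L),
            (if sift (2 ^ ζ) N then (1 : ℝ) else 0) ≤
    1 + 2 * 2 ^ L / ζ * (1 / c) + ∑ p ∈ (Finset.range (2 ^ k)).filter (fun c => c.Prime ∧ 2 ^ ζ ≤ c),
      (2 * 2 ^ L / ζ * (1 / c * (1 / p)) : ℝ) := by
  rw [Finset.sum_boole]
  set A := (Finset.range (2 ^ k)).filter (fun c => c.Prime ∧ 2 ^ ζ ≤ c) with hA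
  have hc0 : 0 < c := lt_of_lt_of_le (by positivity) hc
  have hsub : ((Finset.range (2 ^ L)).filter (fun N => 1 ≤ N ∧ c * N < 2 ^ L)).filter
      (fun N => sift (2 ^ ζ) N) ⊆ {1} ∪ Pz ζ (2 ^ L / c) ∪
      A.biUnion (fun p => (Pz ζ (2 ^ L / (c * p))).image (fun e => p * e)) := by
    intro N hN
    simp only [Finset.mem_filter, Finset.mem_range] at hN
    obtain ⟨⟨hNL, hN1, hcN⟩, hs⟩ := hN
    simp only [Finset.mem_union, Finset.mem_singleton, Finset.mem_biUnion, Finset.mem_image]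
    by_cases h1 : N = 1
    · left; left; exact h1
    have sz : ∀ p, p.Prime → p ∣ N → 2 ^ ζ ≤ p := by
      intro p hp hd
      by_contra h
      exact hs p hp (by omega) hd
    by_cases h2 : N.Prime
    · left; right
      rw [Pz, Finset.mem_filter, Finset.mem_range]
      refine ⟨?_, h2, sz N h2 dvd_rfl⟩
      have : N ≤ 2 ^ L / c := by
        rw [Nat.le_div_iff_mul_le hc0, mul_comm]; exact hcN.le
      omega
    · right
      have hpr := Nat.minFac_prime h1
      have hpz := sz _ hpr (Nat.minFac_dvd N)
      have hsq := Nat.minFac_sq_le_self hN1 h2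
      have hmul := Nat.mul_div_cancel' (Nat.minFac_dvd N)
      set p := N.minFac with hp
      set e := N / p with he
      have hpe : p ≤ e := by
        rw [he, Nat.le_div_iff_mul_le hpr.pos, ← sq]; exact hsq
      have he1 : e ≠ 1 := by have := hpr.two_le; omega
      have hepr : e.Prime := by
        by_contra hnp
        have hq := Nat.minFac_sq_le_self (by have := hpr.two_le; omega : 0 < e) hnp
        have hqz := sz _ (Nat.minFac_prime he1)
          ((Nat.minFac_dvd e).trans (hmul ▸ dvd_mul_left e p))
        have : 2 ^ L ≤ c * N := by
          calc 2 ^ L ≤ 2 ^ (4 * ζ) := Nat.pow_le_pow_right (by norm_num) hL2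
            _ = 2 ^ ζ * (2 ^ ζ * (2 ^ ζ) ^ 2) := by ring
            _ ≤ c * (p * e.minFac ^ 2) := by gcongr
            _ ≤ c * (p * e) := by gcongr
            _ = c * N := by rw [hmul]
        omega
      refine ⟨p, ?_, e, ?_, hmul⟩
      · rw [hA, Finset.mem_filter, Finset.mem_range]
        refine ⟨?_, hpr, hpz⟩
        by_contra hge
        have : 2 ^ L ≤ c * N := by
          calc 2 ^ L ≤ 2 ^ (ζ + 2 * k) := Nat.pow_le_pow_right (by norm_num) hL1
            _ = 2 ^ ζ * (2 ^ k) ^ 2 := by ring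
            _ ≤ c * p ^ 2 := by gcongr; omega
            _ ≤ c * N := by gcongr
        omega
      · rw [Pz, Finset.mem_filter, Finset.mem_range]
        refine ⟨?_, hepr, hpz.trans hpe⟩
        have : e ≤ 2 ^ L / (c * p) := by
          rw [Nat.le_div_iff_mul_le (Nat.mul_pos hc0 hpr.pos)]
          calc e * (c * p) = c * (p * e) := by ring
            _ = c * N := by rw [hmul]
            _ ≤ _ := hcN.le
        omega
  have h1 := Finset.card_le_card hsub
  have h2 : ((((Finset.range (2 ^ L)).filter (fun N => 1 ≤ N ∧ c * N < 2 ^ L)).filter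
      (fun N => sift (2 ^ ζ) N)).card : ℝ) ≤ 1 + (Pz ζ (2 ^ L / c)).card +
      ∑ p ∈ A, ((Pz ζ (2 ^ L / (c * p))).card : ℝ) := by
    have h3 : (((Finset.range (2 ^ L)).filter (fun N => 1 ≤ N ∧ c * N < 2 ^ L)).filter
      (fun N => sift (2 ^ ζ) N)).card ≤ 1 + (Pz ζ (2 ^ L / c)).card +
      ∑ p ∈ A, (Pz ζ (2 ^ L / (c * p))).card := by
      refine h1.trans ((Finset.card_union_le _ _).trans ?_)
      gcongr
      · exact (Finset.card_union_le _ _)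
      · refine Finset.card_biUnion_le.trans (Finset.sum_le_sum fun p _ => Finset.card_image_le)
    exact_mod_cast h3
  refine h2.trans ?_
  have h4 := Pz_card_real ζ (2 ^ L) c hζ
  push_cast at h4
  gcongr with p hp
  have h5 := Pz_card_real ζ (2 ^ L) (c * p) hζ
  push_cast at h5
  rw [one_div_mul_one_div]
  exact h5

open Classical in
lemma pair_count (ζ d L : ℕ) (hζ : 1 ≤ ζ) (hL1 : L ≤ ζ + 2 * (ζ + d)) (hL2 : L ≤ 4 * ζ) :
    ∑ c ∈ (Finset.range (2 ^ (ζ + d))).filter (fun c => c.Prime ∧ 2 ^ ζ ≤ c),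
      ∑ N ∈ (Finset.range (2 ^ L)).filter (fun N => 1 ≤ N ∧ c * N < 2 ^ L),
            (if sift (2 ^ ζ) N then (1 : ℝ) else 0) ≤
    2 ^ (ζ + d) + 2 * 2 ^ L / ζ * (4 * d / ζ + (4 * d / ζ) ^ 2) := by
  have hr := recip_sum ζ hζ d
  set A := (Finset.range (2 ^ (ζ + d))).filter (fun c => c.Prime ∧ 2 ^ ζ ≤ c) with hA
  have hcard : (A.card : ℝ) ≤ 2 ^ (ζ + d) := by
    have : A.card ≤ 2 ^ (ζ + d) := (Finset.card_filter_le _ _).trans (by rw [Finset.card_range])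
    exact_mod_cast this
  have hr0 : 0 ≤ ∑ p ∈ A, (1 / p : ℝ) := Finset.sum_nonneg fun _ _ => by positivity
  calc _ ≤ ∑ c ∈ A, (1 + 2 * 2 ^ L / ζ * (1 / c) + ∑ p ∈ A, (2 * 2 ^ L / ζ * (1 / c * (1 / p)) : ℝ)) := by
        refine Finset.sum_le_sum fun c hc => ?_
        rw [hA, Finset.mem_filter] at hc
        exact inner_count ζ (ζ + d) L c hζ hL1 hL2 hc.2.2
    _ = A.card + 2 * 2 ^ L / ζ * (∑ p ∈ A, (1 / p : ℝ) + (∑ p ∈ A, (1 / p : ℝ)) ^ 2) := by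
        rw [Finset.sum_add_distrib, Finset.sum_add_distrib, sq, Finset.sum_mul_sum]
        simp only [← Finset.mul_sum]
        rw [Finset.sum_const, nsmul_eq_mul, mul_one]
        ring
    _ ≤ _ := by gcongr


def Sd (n : ℕ) : ℕ := (Nat.digits 2 n).sum

lemma Sd_zero : Sd 0 = 0 := by simp [Sd]

lemma Sd_even (n : ℕ) : Sd (2 * n) = Sd n := by
  rcases Nat.eq_zero_or_pos n with h | h
  · subst h; simp
  · have := Nat.digits_add 2 (by norm_num) 0 n (by norm_num) (Or.inr h.ne')
    rw [zero_add] at this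
    simp [Sd, this]

lemma Sd_odd (n : ℕ) : Sd (2 * n + 1) = Sd n + 1 := by
  have := Nat.digits_add 2 (by norm_num) 1 n (by norm_num) (Or.inl (by norm_num))
  rw [Sd, add_comm, this, List.sum_cons, Sd, add_comm]

lemma Sd_add_le (a b : ℕ) : Sd (a + b) ≤ Sd a + Sd b := by
  induction h : a + b using Nat.strong_induction_on generalizing a b with
  | _ n ih =>
    subst h
    obtain ⟨a', ha | ha⟩ := Nat.even_or_odd' a <;> obtain ⟨b', hb | hb⟩ := Nat.even_or_odd' b
    · rw [ha, hb, ← mul_add, Sd_even, Sd_even, Sd_even]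
      rcases Nat.eq_zero_or_pos (a' + b') with h0 | h0
      · have h1 : a' = 0 := by omega
        have h2 : b' = 0 := by omega
        simp [h1, h2, Sd_zero]
      · exact ih (a' + b') (by omega) a' b' rfl
    · rw [ha, hb, ← add_assoc, ← mul_add, Sd_even, Sd_odd, Sd_odd]
      have := ih (a' + b') (by omega) a' b' rfl
      omega
    · rw [ha, hb, show 2 * a' + 1 + 2 * b' = 2 * (a' + b') + 1 by ring, Sd_even, Sd_odd, Sd_odd]
      have := ih (a' + b') (by omega) a' b' rfl
      omega
    · rw [ha, hb, show 2 * a' + 1 + (2 * b' + 1) = 2 * (a' + b' + 1) by ring, Sd_even, Sd_odd, Sd_odd]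
      have := ih (a' + b') (by omega) a' b' rfl
      have h1 : Sd (a' + b' + 1) ≤ Sd (a' + b') + Sd 1 := ih _ (by omega) (a' + b') 1 rfl
      have h2 : Sd 1 = 1 := by simp [Sd]
      omega

lemma Sd_le (n m : ℕ) (h : m < 2 ^ n) : Sd m ≤ n := by
  induction n generalizing m with
  | zero => have : m = 0 := by simpa using h
            simp [this, Sd_zero]
  | succ n ih =>
    rw [pow_succ] at h
    obtain ⟨a, ha | ha⟩ := Nat.even_or_odd' m
    · rw [ha, Sd_even]; have := ih a (by omega); omega
    · rw [ha, Sd_odd]; have := ih a (by omega); omega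

lemma Sd_split (k h b : ℕ) (hb : b < 2 ^ k) : Sd (2 ^ k * h + b) = Sd h + Sd b := by
  induction k generalizing b with
  | zero => have : b = 0 := by simpa using hb
            simp [this, Sd_zero]
  | succ n ih =>
    rw [pow_succ] at hb
    obtain ⟨a, ha | ha⟩ := Nat.even_or_odd' b
    · rw [ha, show 2 ^ (n + 1) * h + 2 * a = 2 * (2 ^ n * h + a) by ring, Sd_even, Sd_even,
        ih a (by omega)]
    · rw [ha, show 2 ^ (n + 1) * h + (2 * a + 1) = 2 * (2 ^ n * h + a) + 1 by ring, Sd_odd, Sd_odd,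
        ih a (by omega), add_assoc]

lemma Sd_mul_pow (k h : ℕ) : Sd (2 ^ k * h) = Sd h := by
  have := Sd_split k h 0 (by positivity)
  rwa [add_zero, Sd_zero, add_zero] at this

lemma Sd_compl (k a b : ℕ) (h : a + b + 1 = 2 ^ k) : Sd a + Sd b = k := by
  induction k generalizing a b with
  | zero => have h1 : a = 0 := by simp at h; omega
            have h2 : b = 0 := by simp at h; omega
            simp [h1, h2, Sd_zero]
  | succ n ih =>
    rw [pow_succ] at h
    obtain ⟨a', ha | ha⟩ := Nat.even_or_odd' a <;> obtain ⟨b', hb | hb⟩ := Nat.even_or_odd' b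
    · omega
    · rw [ha, hb, Sd_even, Sd_odd]; have := ih a' b' (by omega); omega
    · rw [ha, hb, Sd_even, Sd_odd]; have := ih a' b' (by omega); omega
    · omega

lemma Sd_mod_le (k n : ℕ) : Sd (n % 2 ^ k) ≤ Sd n := by
  have := Sd_split k (n / 2 ^ k) (n % 2 ^ k) (Nat.mod_lt _ (by positivity))
  rw [Nat.div_add_mod] at this
  omega

lemma Sd_sum {α : Type} (s : Finset α) (f : α → ℕ) : Sd (∑ i ∈ s, f i) ≤ ∑ i ∈ s, Sd (f i) := by
  classical
  induction s using Finset.induction_on with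
  | empty => simp [Sd_zero]
  | insert a s ha ih =>
    rw [Finset.sum_insert ha, Finset.sum_insert ha]
    have := Sd_add_le (f a) (∑ i ∈ s, f i)
    omega

lemma Sd_gen (t : ℕ) (a : ℝ) : ∑ h ∈ Finset.range (2 ^ t), a ^ Sd h = (1 + a) ^ t := by
  induction t with
  | zero => simp [Sd_zero]
  | succ t ih =>
    have e : 2 ^ (t + 1) = 2 ^ t + 2 ^ t := by ring
    rw [e, Finset.sum_range_add, ih]
    have : ∀ x ∈ Finset.range (2 ^ t), a ^ Sd (2 ^ t + x) = a * a ^ Sd x := by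
      intro x hx
      have h1 := Sd_split t 1 x (Finset.mem_range.1 hx)
      have h2 : Sd 1 = 1 := by simp [Sd]
      rw [mul_one, h2] at h1
      rw [h1, pow_add, pow_one]
    rw [Finset.sum_congr rfl this, ← Finset.mul_sum, ih]
    ring

lemma bad_tops (t m : ℕ) (a : ℝ) (ha : 0 < a) (ha1 : a ≤ 1) :
    (((Finset.range (2 ^ t)).filter (fun h => Sd h < m)).card : ℝ) * a ^ m ≤ (1 + a) ^ t := by
  rw [← Sd_gen, ← nsmul_eq_mul]
  calc _ ≤ ∑ h ∈ (Finset.range (2 ^ t)).filter (fun h => Sd h < m), a ^ Sd h := by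
        apply Finset.card_nsmul_le_sum
        intro h hh
        rw [Finset.mem_filter] at hh
        exact pow_le_pow_of_le_one ha.le ha1 hh.2.le
    _ ≤ _ := Finset.sum_le_sum_of_subset_of_nonneg (Finset.filter_subset _ _)
        (fun _ _ _ => by positivity)

lemma low_digits (r K r' n : ℕ) (hr : 1 ≤ r) (i : Ix r K r') (h : bv r K r' i = (n : ZMod (2 ^ (K * r)))) :
    K * r ≤ Sd (n % 2 ^ (K * r)) + (2 * r - 1 + K * r') := by
  set q := 2 ^ (K * r) with hq
  have hq0 : 0 < q := by positivity
  set C := 2 * (i.1 : ℕ) + ∑ l : Fin K, 2 ^ (((l : ℕ) + 1) * r) * (i.2 l : ℕ) with hC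
  have hcv : cv r i.1 i.2 = C + 1 := by
    simp only [cv, hC]; ring
  have hdvd : q ∣ n + (C + 1) := by
    rw [← ZMod.natCast_eq_zero_iff, Nat.cast_add, ← hcv, ← h]
    simp [bv]
  have hSC : Sd C ≤ 2 * r - 1 + K * r' := by
    refine (Sd_add_le _ _).trans ?_
    gcongr
    · rw [Sd_even]; exact Sd_le _ _ i.1.2
    · refine (Sd_sum _ _).trans ?_
      calc _ ≤ ∑ l : Fin K, r' := by
            refine Finset.sum_le_sum fun l _ => ?_
            rw [Sd_mul_pow]; exact Sd_le _ _ (i.2 l).2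
        _ = K * r' := by simp
  have h1 := Sd_mod_le (K * r) C
  rw [← hq] at h1
  have hlt1 := Nat.mod_lt n hq0
  have hlt2 := Nat.mod_lt C hq0
  have hd2 : q ∣ n % q + C % q + 1 := by
    have e : n + (C + 1) = (n % q + C % q + 1) + q * (n / q + C / q) := by
      have := Nat.div_add_mod n q
      have := Nat.div_add_mod C q
      rw [mul_add]; omega
    rw [e] at hdvd
    exact (Nat.dvd_add_left (dvd_mul_right _ _)).1 hdvd
  have heq : n % q + C % q + 1 = q := by
    obtain ⟨w, hw⟩ := hd2
    have hw1 : w = 1 := by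
      have : w < 2 := by
        by_contra hh
        have : q * 2 ≤ q * w := Nat.mul_le_mul_left _ (by omega)
        omega
      have : w ≠ 0 := by rintro rfl; omega
      omega
    rw [hw, hw1, mul_one]
  have := Sd_compl (K * r) _ _ heq
  omega

lemma bad_sum (r K r' L m : ℕ) (hr : 1 ≤ r) (hkL : K * r ≤ L)
    (hm : 2 * L + 3 * (2 * r - 1 + K * r') ≤ 3 * (m + K * r)) :
    ∑ n ∈ (Finset.range (2 ^ L)).filter (fun n => 3 * Sd n < 2 * L),
      Wt (2 ^ (K * r)) (bv r K r') n ≤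
    Fintype.card (Ix r K r') *
      ((Finset.range (2 ^ (L - K * r))).filter (fun h => Sd h < m)).card := by
  classical
  simp only [Wt]
  rw [Finset.sum_comm]
  have key : ∀ i : Ix r K r', ∑ n ∈ (Finset.range (2 ^ L)).filter (fun n => 3 * Sd n < 2 * L),
      (if bv r K r' i = (n : ZMod (2 ^ (K * r))) then (1 : ℝ) else 0) ≤
      ((Finset.range (2 ^ (L - K * r))).filter (fun h => Sd h < m)).card := by
    intro i
    rw [Finset.sum_boole]
    rw [Nat.cast_le]
    apply Finset.card_le_card_of_injOn (fun n => n / 2 ^ (K * r))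
    · intro n hn
      simp only [Finset.coe_filter, Finset.mem_filter, Finset.mem_range, Set.mem_setOf_eq] at hn ⊢
      obtain ⟨⟨h1, h2⟩, h3⟩ := hn
      refine ⟨?_, ?_⟩
      · rw [Nat.div_lt_iff_lt_mul (by positivity), ← pow_add, Nat.sub_add_cancel hkL]; exact h1
      · have h4 := low_digits r K r' n hr i h3
        have h5 := Sd_split (K * r) (n / 2 ^ (K * r)) (n % 2 ^ (K * r)) (Nat.mod_lt _ (by positivity))
        rw [Nat.div_add_mod] at h5
        omega
    · intro n hn n' hn' he
      simp only [Finset.coe_filter, Finset.mem_filter, Finset.mem_range, Set.mem_setOf_eq] at hn hn'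
      have h1 : (n : ZMod (2 ^ (K * r))) = n' := hn.2.symm.trans hn'.2
      rw [ZMod.natCast_eq_natCast_iff'] at h1
      rw [← Nat.div_add_mod n (2 ^ (K * r)), ← Nat.div_add_mod n' (2 ^ (K * r)), h1]
      simp only at he
      rw [he]
  calc _ ≤ ∑ i : Ix r K r', (((Finset.range (2 ^ (L - K * r))).filter (fun h => Sd h < m)).card : ℝ) :=
        Finset.sum_le_sum fun i _ => key i
    _ = _ := by rw [Finset.sum_const, nsmul_eq_mul, Finset.card_univ]


lemma final_alg (I Q T D Z P R B L ζ s sg e1 e2 e3 : ℝ) (hI : 0 < I) (hQ1 : 1 ≤ Q) (hD : 0 < D)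
    (he1 : 0 ≤ e1) (he2 : 0 ≤ e2) (he3 : 0 ≤ e3)
    (hs : 1 ≤ s) (hL : L = 1206 * s) (hζ : ζ = 400 * s) (hQD : Q * D = T) (hZQ : Z ≤ Q)
    (hQT : Q ^ 2 ≤ T * e1) (hsg : 1 / sg = e2) (hB : B ≤ D * e3)
    (hcnt : T / L - 3 - Z ≤ P)
    (hpair : R ≤ Q + 2 * T / ζ * (4 * (3 * s) / ζ + (4 * (3 * s) / ζ) ^ 2))
    (hmain : I / (Q / 2) * (P - R) - I - 3 * (I * (L + 1) * Q + (L + 1) ^ 4 * (4 * (I / sg) * T / Q))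
      ≤ I * B) :
    (1.6 : ℝ) ≤ 14 * (L + 1) ^ 2 * e1 + 12 * (L + 1) ^ 5 * e2 + (L + 1) * e3 := by
  have hQ0 : 0 < Q := by linarith
  have hT0 : 0 < T := by rw [← hQD]; positivity
  have hs0 : 0 < s := by linarith
  have hL0 : 0 < L := by rw [hL]; positivity
  -- main difference
  have h1 : 0.8 * (T / L) - 3 - 2 * Q ≤ P - R := by
    have e : 2 * T / ζ * (4 * (3 * s) / ζ + (4 * (3 * s) / ζ) ^ 2) = 0.186327 * (T / L) := by
      rw [hζ, hL]; field_simp; norm_num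
    rw [e] at hpair
    have : 0 < T / L := by positivity
    linarith
  have h2 : I / (Q / 2) * (0.8 * (T / L) - 3 - 2 * Q) ≤ I / (Q / 2) * (P - R) := by gcongr
  have h3 : I * B ≤ I * (D * e3) := by gcongr
  have h4 : I / (Q / 2) * (0.8 * (T / L) - 3 - 2 * Q) - I -
      3 * (I * (L + 1) * Q + (L + 1) ^ 4 * (4 * (I / sg) * T / Q)) ≤ I * (D * e3) := by linarith
  have h5 : I / sg = I * e2 := by rw [← hsg]; ring
  rw [h5] at h4
  have h6 : I * (D * e3) * (Q * L / (I * T)) = L * e3 := by rw [← hQD]; field_simp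
  have h7 : (I / (Q / 2) * (0.8 * (T / L) - 3 - 2 * Q) - I -
      3 * (I * (L + 1) * Q + (L + 1) ^ 4 * (4 * (I * e2) * T / Q))) * (Q * L / (I * T)) =
      1.6 - L * (6 + 5 * Q + 3 * (L + 1) * Q ^ 2) / T - 12 * L * (L + 1) ^ 4 * e2 := by
    field_simp
    ring
  have h8 := mul_le_mul_of_nonneg_right h4 (by positivity : 0 ≤ Q * L / (I * T))
  rw [h6, h7] at h8
  have h9 : L * (6 + 5 * Q + 3 * (L + 1) * Q ^ 2) / T ≤ 14 * (L + 1) ^ 2 * e1 := by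
    rw [div_le_iff₀ hT0]
    have hQQ : Q ≤ Q ^ 2 := by nlinarith
    calc L * (6 + 5 * Q + 3 * (L + 1) * Q ^ 2) ≤ (L + 1) * (14 * (L + 1) * Q ^ 2) := by
          have : 6 + 5 * Q + 3 * (L + 1) * Q ^ 2 ≤ 14 * (L + 1) * Q ^ 2 := by
            have : 0 ≤ L * Q ^ 2 := by positivity
            nlinarith
          gcongr
          linarith
      _ = 14 * (L + 1) ^ 2 * Q ^ 2 := by ring
      _ ≤ 14 * (L + 1) ^ 2 * (T * e1) := by gcongr
      _ = _ := by ring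
  have h10 : 12 * L * (L + 1) ^ 4 * e2 ≤ 12 * (L + 1) ^ 5 * e2 := by
    have e : 12 * (L + 1) ^ 5 * e2 = 12 * L * (L + 1) ^ 4 * e2 + 12 * ((L + 1) ^ 4 * e2) := by ring
    have : 0 ≤ (L + 1) ^ 4 * e2 := by positivity
    rw [e]
    linarith
  have h11 : L * e3 ≤ (L + 1) * e3 := by
    rw [add_mul]; linarith
  linarith

lemma core (g s u r K L ζ m : ℕ) (a ρ : ℝ) (ha : 0 < a) (ha1 : a ≤ 1)
    (hρ : ρ = ((1 + a) / 2) ^ 3212 / a ^ 1605) (hρ1 : ρ ≤ 1)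
    (hg : 1 ≤ g) (hL : L = 1206 * s) (hζ : ζ = 400 * s) (hk : K * r = 403 * s) (hs : s = 4 * u)
    (hgu : g ≤ u) (hr : g + 1 ≤ r) (hK : 1 ≤ K) (hmu : m = 1605 * u)
    (hm : 2 * L + 3 * (2 * r - 1 + K * g) ≤ 3 * (m + K * r))
    (hno : ∀ p : ℕ, p.Prime → 2 ^ ζ ≤ p → p < 2 ^ L → 3 * Sd p < 2 * L) :
    (1.6 : ℝ) ≤ 14 * (L + 1) ^ 2 * (1 / 2) ^ g + 12 * (L + 1) ^ 5 * (1 / √2) ^ g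
      + (L + 1) * ρ ^ g := by
  have hs1 : 1 ≤ s := by omega
  set I : ℝ := (Fintype.card (Ix r K g) : ℝ) with hI
  have hI0 : 0 < I := by
    rw [hI, card_Ix]; positivity
  have hsq0 : (0 : ℝ) < √(2 ^ g) := by positivity
  have hlow := prime_lower (K * r) L (2 ^ ζ) (bv r K g) (bv_unit (by omega)) (I / √(2 ^ g))
    (by positivity) (fun χ hχ => char_sum_bound hr hK χ hχ) (by omega) (by omega)
    (by rw [← pow_add]; exact Nat.pow_le_pow_right (by norm_num) (by omega))
    (by
      calc 3 ≤ 2 ^ 2 := by norm_num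
        _ ≤ 2 ^ ζ := Nat.pow_le_pow_right (by norm_num) (by omega))
    (Nat.pow_le_pow_right (by norm_num) (by omega))
  have hbad := bad_sum r K g L m (by omega) (by omega) hm
  have hle : ∑ N ∈ (Finset.range (2 ^ L)).filter (fun N => N.Prime ∧ 2 ^ ζ ≤ N),
      Wt (2 ^ (K * r)) (bv r K g) N ≤ 
      ∑ n ∈ (Finset.range (2 ^ L)).filter (fun n => 3 * Sd n < 2 * L),
      Wt (2 ^ (K * r)) (bv r K g) n := by
    apply Finset.sum_le_sum_of_subset_of_nonneg
    · intro p hp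
      rw [Finset.mem_filter, Finset.mem_range] at hp ⊢
      exact ⟨hp.1, hno p hp.2.1 hp.2.2 hp.1⟩
    · intro p _ _
      exact Wt_nonneg _ _ _
  have hcnt := prime_count_lower L (2 ^ ζ) (by omega)
  have hpair := pair_count ζ (3 * s) L (by omega) (by omega) (by omega)
  have hkd : ζ + 3 * s = K * r := by omega
  rw [hkd] at hpair
  have htops := bad_tops (L - K * r) m a ha ha1
  have hQt : (2 : ℝ) ^ (K * r) * 2 ^ (L - K * r) = 2 ^ L := by
    rw [← pow_add]; congr 1; omega
  have htot : ((2 ^ (K * r)).totient : ℝ) = 2 ^ (K * r) / 2 := by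
    obtain ⟨w, hw⟩ : ∃ w, K * r = w + 1 := ⟨K * r - 1, by omega⟩
    rw [hw, Nat.totient_prime_pow_succ Nat.prime_two]
    push_cast
    rw [pow_succ]; ring
  rw [htot] at hlow
  have hmain := hlow.trans (hle.trans hbad)
  rw [← hI] at hmain
  clear hlow hle hbad
  set B : ℝ := (((Finset.range (2 ^ (L - K * r))).filter (fun h => Sd h < m)).card : ℝ) with hB
  -- bound on B
  have hBb : B ≤ 2 ^ (L - K * r) * ρ ^ g := by
    have hρ0 : 0 ≤ ρ := by rw [hρ]; positivity
    have h1 : ρ ^ u ≤ ρ ^ g := pow_le_pow_of_le_one hρ0 hρ1 hgu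
    have h2 : B ≤ 2 ^ (L - K * r) * ρ ^ u := by
      have e1 : L - K * r = 3212 * u := by omega
      rw [e1] at htops ⊢
      rw [hmu] at htops
      rw [hρ, div_pow, ← pow_mul, ← pow_mul, div_pow, mul_div_assoc', mul_div_cancel₀ _ (by positivity),
        le_div_iff₀ (by positivity)]
      exact htops
    exact h2.trans (by gcongr)
  have hZQ : (2 : ℝ) ^ ζ ≤ 2 ^ (K * r) := pow_le_pow_right₀ (by norm_num) (by omega)
  have hQ1 : (1 : ℝ) ≤ 2 ^ (K * r) := one_le_pow₀ (by norm_num)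
  have hQT : ((2 : ℝ) ^ (K * r)) ^ 2 ≤ 2 ^ L * (1 / 2) ^ g := by
    rw [one_div, inv_pow, ← div_eq_mul_inv, le_div_iff₀ (by positivity), ← pow_mul, ← pow_add]
    exact pow_le_pow_right₀ (by norm_num) (by omega)
  have hsqrt : 1 / √(2 ^ g) = (1 / √2) ^ g := by
    rw [div_pow, one_pow]
    congr 1
    rw [Real.sqrt_eq_iff_mul_self_eq (by positivity) (by positivity), ← mul_pow,
      Real.mul_self_sqrt (by norm_num)]
  have hsR : (1 : ℝ) ≤ s := by exact_mod_cast hs1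
  have hLR : (L : ℝ) = 1206 * s := by rw [hL]; push_cast; ring
  have hζR : (ζ : ℝ) = 400 * s := by rw [hζ]; push_cast; ring
  push_cast at hcnt hpair hmain
  exact final_alg I (2 ^ (K * r)) (2 ^ L) (2 ^ (L - K * r)) (2 ^ ζ) _ _ B L ζ s (√(2 ^ g)) _ _ _
    hI0 hQ1 (by positivity) (by positivity) (by positivity) (by rw [hρ]; positivity) hsR hLR hζR hQt hZQ
    hQT hsqrt hBb hcnt hpair hmain

set_option exponentiation.threshold 5000 in
lemma rho_lt : ((1 + (801 / 802 : ℝ)) / 2) ^ 3212 / (801 / 802 : ℝ) ^ 1605 < 1 := by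
  have h : 1603 ^ 3212 * 802 ^ 1605 < 1604 ^ 3212 * 801 ^ 1605 := by norm_num
  have hR : (1603 : ℝ) ^ 3212 * 802 ^ 1605 < 1604 ^ 3212 * 801 ^ 1605 := by exact_mod_cast h
  have e : (1 + (801 / 802 : ℝ)) / 2 = 1603 / 1604 := by norm_num
  rw [e, div_lt_one (by positivity), div_pow, div_pow, div_lt_div_iff₀ (by positivity) (by positivity)]
  rw [mul_comm (801 ^ 1605 : ℝ)]
  exact hR


lemma asym (C ρ : ℝ) (hρ0 : 0 ≤ ρ) (hρ1 : ρ < 1) :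
    ∀ᶠ g : ℕ in Filter.atTop, 14 * (C * g) ^ 2 * (1 / 2) ^ g + 12 * (C * g) ^ 5 * (1 / √2) ^ g
      + (C * g) * ρ ^ g < 1.6 := by
  have hs2 : |1 / √2| < 1 := by
    rw [abs_of_nonneg (by positivity), div_lt_one (by positivity)]
    exact Real.lt_sqrt_of_sq_lt (by norm_num)
  have t1 := (tendsto_pow_const_mul_const_pow_of_abs_lt_one 2
    (by rw [abs_of_pos] <;> norm_num : |(1 / 2 : ℝ)| < 1)).const_mul (14 * C ^ 2)
  have t2 := (tendsto_pow_const_mul_const_pow_of_abs_lt_one 5 hs2).const_mul (12 * C ^ 5)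
  have t3 := (tendsto_pow_const_mul_const_pow_of_abs_lt_one 1
    (by rwa [abs_of_nonneg hρ0] : |ρ| < 1)).const_mul C
  have t := (t1.add t2).add t3
  simp only [mul_zero, add_zero] at t
  have := t.eventually (gt_mem_nhds (by norm_num : (0 : ℝ) < 1.6))
  filter_upwards [this] with g hg
  refine lt_of_eq_of_lt ?_ hg
  simp only [mul_pow]
  ring

theorem infinite_primes_twice_as_many_ones :
    {p : ℕ | p.Prime ∧
      2 * ((Nat.digits 2 p).length - (Nat.digits 2 p).sum) ≤ (Nat.digits 2 p).sum}.Infinite := by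
  apply Set.infinite_of_forall_exists_gt
  intro n
  obtain ⟨ρ, hρ⟩ : ∃ ρ : ℝ, ρ = ((1 + (801 / 802 : ℝ)) / 2) ^ 3212 / (801 / 802 : ℝ) ^ 1605 :=
    ⟨_, rfl⟩
  have hρ1 : ρ < 1 := by rw [hρ]; exact rho_lt
  have hρ0 : 0 ≤ ρ := by rw [hρ]; positivity
  obtain ⟨g, hE, hgn⟩ := ((asym 124420609 ρ hρ0 hρ1).and (Filter.eventually_ge_atTop (n + 1))).exists
  obtain ⟨u, hu⟩ : ∃ u, u = 25792 * g := ⟨_, rfl⟩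
  obtain ⟨s, hs⟩ : ∃ s, s = 4 * u := ⟨_, rfl⟩
  obtain ⟨L, hL⟩ : ∃ L, L = 1206 * s := ⟨_, rfl⟩
  obtain ⟨ζ, hζ⟩ : ∃ ζ, ζ = 400 * s := ⟨_, rfl⟩
  obtain ⟨r, hr⟩ : ∃ r, r = 3224 * g := ⟨_, rfl⟩
  obtain ⟨K, hK⟩ : ∃ K, K = 12896 := ⟨_, rfl⟩
  have hKr : K * r = 403 * s := by rw [hK]; omega
  have hKg : K * g = 12896 * g := by rw [hK]
  by_contra hcon
  push Not at hcon
  have hno : ∀ p : ℕ, p.Prime → 2 ^ ζ ≤ p → p < 2 ^ L → 3 * Sd p < 2 * L := by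
    intro p hp hz hpL
    by_contra hge
    have hlen : (Nat.digits 2 p).length ≤ L := by
      rw [Nat.digits_length_le_iff (by norm_num)]; exact hpL
    have hS : Sd p = (Nat.digits 2 p).sum := rfl
    have h1 := hcon p ⟨hp, by omega⟩
    have h2 : ζ < 2 ^ ζ := Nat.lt_two_pow_self
    omega
  have hfin := core g s u r K L ζ (1605 * u) (801 / 802) ρ (by norm_num) (by norm_num) hρ hρ1.le
    (by omega) hL hζ hKr hs (by omega) (by omega) (by omega) rfl (by omega) hno
  have hLg : (L : ℝ) + 1 ≤ 124420609 * g := by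
    have : L + 1 ≤ 124420609 * g := by omega
    exact_mod_cast this
  have : 14 * ((L : ℝ) + 1) ^ 2 * (1 / 2) ^ g + 12 * (L + 1) ^ 5 * (1 / √2) ^ g + (L + 1) * ρ ^ g ≤
    14 * (124420609 * g : ℝ) ^ 2 * (1 / 2) ^ g + 12 * (124420609 * g) ^ 5 * (1 / √2) ^ g
      + (124420609 * g) * ρ ^ g := by gcongr
  linarith
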